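/- Let ν ≥ −1/2, let N ≥ 0 be an integer, and let p ∈ (0,∞]. Then lim_{n→∞} n^{−2N−(2ν+2)/p} · sup over nonzero R ∈ P_{n,1} of |(Ge_{ν+1/2})^N(R)(1)| / ‖R‖_{L_{p,(1−t²)^ν}([−1,1])} exists and equals 2^{1/p} times sup over nonzero f ∈ E_{1,1,e} with ‖f‖_{L_{p,|t|^{2ν+1}}(ℝ)} < ∞ of |(Be_ν)^N(f)(0)| / ‖f‖_{L_{p,|t|^{2ν+1}}(ℝ)} (conventions: 1/∞ = 0, 2^{1/∞} = 1). Moreover, there exists a nonzero f_0 ∈ E_{1,1,e} with ‖f_0‖_{L_{p,|t|^{2ν+1}}(ℝ)} < ∞ such that this limit equals 2^{1/p} · |(Be_ν)^N(f_0)(0)| / ‖f_0‖_{L_{p,|t|^{2ν+1}}(ℝ)}. -/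

import Mathlib

open MeasureTheory Filter Topology Polynomial ENNReal

noncomputable section

/-- `f : ℂ → ℂ` is an entire function of exponential type `σ`. -/
def SphericalType1 (σ : ℝ) (f : ℂ → ℂ) : Prop :=
  Differentiable ℂ f ∧ ∀ ε : ℝ, 0 < ε → ∃ C : ℝ, ∀ z, ‖f z‖ ≤ C * Real.exp (σ * (1 + ε) * ‖z‖)

/-- The Bessel operator `Be_ν(φ)(r) = φ''(r) + (2ν+1)φ'(r)/r`, with the value at `0`
given by continuity (for even analytic `φ` this is `(2ν+2)φ''(0)`). -/
def besselOp (ν : ℝ) (f : ℂ → ℂ) : ℂ → ℂ := fun z =>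
  if z = 0 then (2*ν+2) * deriv (deriv f) 0
  else deriv (deriv f) z + (2*ν+1) * (deriv f z / z)

/-- The Gegenbauer operator `Ge_λ(φ)(t) = (1-t²)φ''(t) - (2λ+1)tφ'(t)` on polynomials. -/
def gegenOp (l : ℝ) (Q : Polynomial ℂ) : Polynomial ℂ :=
  (1 - X ^ 2) * derivative (derivative Q) - C ((2 * l + 1 : ℝ) : ℂ) * X * derivative Q

/-- The weighted measure `|t|^{2ν+1} dt` on `ℝ`. -/
def wMeasR (ν : ℝ) : Measure ℝ :=
  volume.withDensity fun t => ENNReal.ofReal (|t| ^ (2 * ν + 1))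

/-- The sharp constant over polynomials of degree at most `n` for `(Ge_{ν+1/2})^N`
at the point `1` in `L_{p,(1-t²)^ν}([-1,1])`. -/
def gegenPolyConst (ν : ℝ) (N : ℕ) (p : ℝ≥0∞) (n : ℕ) : ℝ≥0∞ :=
  ⨆ (R : Polynomial ℂ) (_ : R.natDegree ≤ n ∧ R ≠ 0),
    (‖((gegenOp (ν + 1/2))^[N] R).eval 1‖₊ : ℝ≥0∞) /
      eLpNorm (fun t : ℝ => R.eval (t : ℂ)) p
        ((volume.restrict (Set.Icc (-1 : ℝ) 1)).withDensity
          fun t => ENNReal.ofReal ((1 - t ^ 2) ^ ν))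

/-- The sharp constant over even entire functions of exponential type `1` for
`(Be_ν)^N` at `0` in `L_{p,|t|^{2ν+1}}(ℝ)`. -/
def entireConst (ν : ℝ) (N : ℕ) (p : ℝ≥0∞) : ℝ≥0∞ :=
  ⨆ (f : ℂ → ℂ)
    (_ : SphericalType1 1 f ∧ (∀ z : ℂ, f (-z) = f z) ∧ f ≠ 0 ∧
      eLpNorm (fun t : ℝ => f t) p (wMeasR ν) ≠ ⊤),
    (‖(besselOp ν)^[N] f 0‖₊ : ℝ≥0∞) / eLpNorm (fun t : ℝ => f t) p (wMeasR ν)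


/-- Phragmén–Lindelöf in the upper half plane. -/
lemma pl_upper {σ M : ℝ} {f : ℂ → ℂ} (hσ : 0 < σ) (hf : SphericalType1 σ f)
    (hM : ∀ x : ℝ, ‖f x‖ ≤ M) {z : ℂ} (hz : 0 ≤ z.im) :
    ‖f z‖ ≤ M * Real.exp (σ * z.im) := by
  obtain ⟨hd, hg⟩ := hf
  have key : ∀ ε : ℝ, 0 < ε → ‖f z‖ ≤ M * Real.exp (σ * (1 + ε) * z.im) := by
    intro ε hε
    obtain ⟨C, hC⟩ := hg ε hε
    set b : ℝ := σ * (1 + ε) with hb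
    have hb0 : 0 < b := by positivity
    -- g w = f (I w) * exp (- b w)
    let g : ℂ → ℂ := fun w => f (Complex.I * w) * Complex.exp (-(b : ℂ) * w)
    have hgd : Differentiable ℂ g := by
      have h1 : Differentiable ℂ fun w : ℂ => f (Complex.I * w) :=
        hd.comp (differentiable_id.const_mul _)
      exact h1.mul (by fun_prop)
    have hgn : ∀ w, ‖g w‖ = ‖f (Complex.I * w)‖ * Real.exp (-b * w.re) := by
      intro w
      simp [g, Complex.norm_exp]
    have hC0 : 0 ≤ C := by
      have := (norm_nonneg _).trans (hC 0)
      simpa using this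
    have h := PhragmenLindelof.right_half_plane_of_bounded_on_real (f := g) (C := M)
      (z := -Complex.I * z) hgd.diffContOnCl
      ⟨1, by norm_num, 2 * b, by
        refine Asymptotics.IsBigO.of_bound C (Eventually.of_forall fun w => ?_)
        rw [hgn, Real.norm_eq_abs, abs_of_pos (Real.exp_pos _), Real.rpow_one]
        have h1 := hC (Complex.I * w)
        rw [norm_mul, Complex.norm_I, one_mul] at h1
        have h2 : Real.exp (-b * w.re) ≤ Real.exp (b * ‖w‖) := by
          apply Real.exp_le_exp.2
          have := (abs_le.1 (Complex.abs_re_le_norm w)).1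
          nlinarith
        calc _ ≤ (C * Real.exp (b * ‖w‖)) * Real.exp (b * ‖w‖) := by gcongr
          _ = C * Real.exp (2 * b * ‖w‖) := by rw [mul_assoc, ← Real.exp_add]; ring_nf⟩
      ⟨C, by
        rw [eventually_map]
        filter_upwards [eventually_ge_atTop (0:ℝ)] with x hx
        rw [hgn]
        have h1 := hC (Complex.I * x)
        rw [norm_mul, Complex.norm_I, one_mul, Complex.norm_real, Real.norm_eq_abs,
          abs_of_nonneg hx] at h1
        calc _ ≤ (C * Real.exp (b * x)) * Real.exp (-b * x) := by
                rw [Complex.ofReal_re]; gcongr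
          _ = C := by rw [mul_assoc, ← Real.exp_add]; ring_nf; simp⟩
      (by
        intro x
        rw [hgn]
        have : Complex.I * (x * Complex.I) = ((-x : ℝ) : ℂ) := by
          push_cast; linear_combination (x:ℂ) * Complex.I_mul_I
        rw [this]
        simpa using hM (-x))
      (by simpa using hz)
    rw [hgn] at h
    have e1 : Complex.I * (-Complex.I * z) = z := by
      linear_combination (-z) * Complex.I_mul_I
    have e2 : (-Complex.I * z).re = z.im := by simp
    rw [e1, e2] at h
    calc ‖f z‖ = ‖f z‖ * Real.exp (-b * z.im) * Real.exp (b * z.im) := by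
            rw [mul_assoc, ← Real.exp_add]; ring_nf; simp
      _ ≤ M * Real.exp (b * z.im) := by gcongr
  have ht : Tendsto (fun ε : ℝ => M * Real.exp (σ * (1 + ε) * z.im)) (𝓝[>] 0)
      (𝓝 (M * Real.exp (σ * (1 + 0) * z.im))) := by
    apply Tendsto.mono_left _ nhdsWithin_le_nhds
    exact Continuous.tendsto (by fun_prop) 0
  have := ge_of_tendsto ht (by
    filter_upwards [self_mem_nhdsWithin] with ε hε using key ε hε)
  simpa using this

lemma pl_bound {σ M : ℝ} {f : ℂ → ℂ} (hσ : 0 < σ) (hf : SphericalType1 σ f)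
    (hM : ∀ x : ℝ, ‖f x‖ ≤ M) (z : ℂ) :
    ‖f z‖ ≤ M * Real.exp (σ * |z.im|) := by
  rcases le_total 0 z.im with h | h
  · rw [abs_of_nonneg h]; exact pl_upper hσ hf hM h
  · rw [abs_of_nonpos h]
    have := pl_upper (f := fun w => f (-w)) (M := M) (z := -z) hσ
      ⟨hf.1.comp differentiable_neg, fun ε hε => by
        obtain ⟨C, hC⟩ := hf.2 ε hε
        exact ⟨C, fun w => by simpa using hC (-w)⟩⟩
      (fun x => by simpa using hM (-x)) (by simpa using h)
    simpa using this

/-- crude Bernstein inequality -/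
lemma bern_lip {M : ℝ} {f : ℂ → ℂ} (hd : Differentiable ℂ f)
    (hM : ∀ z : ℂ, ‖f z‖ ≤ M * Real.exp (|z.im|)) (x y : ℝ) :
    ‖f x - f y‖ ≤ 3 * M * |x - y| := by
  have hM0 : 0 ≤ M := by
    have := (norm_nonneg _).trans (hM 0)
    simpa using this
  have hder : ∀ x : ℝ, ‖deriv f x‖ ≤ 3 * M := by
    intro x
    have := Complex.norm_deriv_le_of_forall_mem_sphere_norm_le (c := (x:ℂ)) (R := 1) (C := 3 * M)
      one_pos hd.diffContOnCl (by
        intro z hz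
        refine (hM z).trans ?_
        have h1 : |z.im| ≤ 1 := by
          have := Complex.abs_im_le_norm (z - x)
          rw [mem_sphere_iff_norm] at hz
          rw [hz] at this
          simpa using this
        have h2 : Real.exp |z.im| ≤ 3 := by
          calc _ ≤ Real.exp 1 := Real.exp_le_exp.2 h1
            _ ≤ 3 := Real.exp_one_lt_d9.le.trans (by norm_num)
        nlinarith)
    simpa using this
  have hda : ∀ x : ℝ, HasDerivAt (fun t : ℝ => f t) (deriv f x) x := fun x =>
    (hd (x:ℂ)).hasDerivAt.comp_ofReal
  have := Convex.norm_image_sub_le_of_norm_hasDerivWithin_le (f := fun t : ℝ => f t)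
    (f' := fun t : ℝ => deriv f t) (C := 3 * M) (s := Set.univ)
    (fun t _ => (hda t).hasDerivWithinAt) (fun t _ => hder t) convex_univ
    (Set.mem_univ y) (Set.mem_univ x)
  simpa using this

lemma norm_cos_le (w : ℂ) : ‖Complex.cos w‖ ≤ Real.exp ‖w‖ := by
  rw [Complex.cos, norm_div]
  have h1 : ‖Complex.exp (w * Complex.I)‖ ≤ Real.exp ‖w‖ := by
    refine (Complex.norm_exp_le_exp_norm _).trans ?_
    simp
  have h2 : ‖Complex.exp (-w * Complex.I)‖ ≤ Real.exp ‖w‖ := by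
    refine (Complex.norm_exp_le_exp_norm _).trans ?_
    simp
  have := norm_add_le (Complex.exp (w * Complex.I)) (Complex.exp (-w * Complex.I))
  rw [Complex.norm_ofNat]
  linarith

/-- `R(cos(z/n))` is of exponential type one. -/
lemma poly_cos_type {n : ℕ} (hn : 0 < n) {R : Polynomial ℂ} (hR : R.natDegree ≤ n) :
    SphericalType1 1 (fun z => R.eval (Complex.cos (z / n))) := by
  refine ⟨?_, ?_⟩
  · have h1 : Differentiable ℂ (fun z : ℂ => Complex.cos (z / n)) := by fun_prop
    exact (Polynomial.differentiable R).comp h1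
  · intro ε hε
    refine ⟨∑ i ∈ Finset.range (n + 1), ‖R.coeff i‖, fun z => ?_⟩
    beta_reduce
    rw [Polynomial.eval_eq_sum_range' (Nat.lt_succ_of_le hR), Finset.sum_mul]
    refine (norm_sum_le _ _).trans (Finset.sum_le_sum fun i hi => ?_)
    rw [norm_mul, norm_pow]
    gcongr
    have hn' : (0:ℝ) < n := by exact_mod_cast hn
    have hi' : (i:ℝ) ≤ n := by
      have := Finset.mem_range.1 hi
      exact_mod_cast Nat.lt_succ_iff.1 this
    calc ‖Complex.cos (z / n)‖ ^ i ≤ (Real.exp ‖z / n‖) ^ i := by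
            gcongr; exact norm_cos_le _
      _ = Real.exp (i * ‖z / n‖) := by rw [← Real.exp_nat_mul]
      _ ≤ Real.exp (1 * (1 + ε) * ‖z‖) := by
        apply Real.exp_le_exp.2
        rw [norm_div, Complex.norm_natCast]
        calc (i:ℝ) * (‖z‖ / n) ≤ n * (‖z‖ / n) := by gcongr
          _ = ‖z‖ := by field_simp
          _ ≤ _ := by nlinarith [norm_nonneg z]

lemma poly_cos_bound {n : ℕ} (hn : 0 < n) {R : Polynomial ℂ} (hR : R.natDegree ≤ n) {M : ℝ}
    (hM : ∀ t ∈ Set.Icc (-1:ℝ) 1, ‖R.eval (t:ℂ)‖ ≤ M) (z : ℂ) :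
    ‖R.eval (Complex.cos (z / n))‖ ≤ M * Real.exp |z.im| := by
  have := pl_bound (M := M) one_pos (poly_cos_type hn hR) (by
    intro x
    have := hM (Real.cos (x / n)) ⟨Real.neg_one_le_cos _, Real.cos_le_one _⟩
    simpa using this) z
  simpa using this

/-- Taylor coefficients at the origin -/
def tay (F : ℂ → ℂ) (j : ℕ) : ℂ := iteratedDeriv j F 0 / (Nat.factorial j : ℂ)

lemma hasSum_tay {F : ℂ → ℂ} (hF : Differentiable ℂ F) (z : ℂ) :
    HasSum (fun j => tay F j * z ^ j) (F z) := by
  have := Complex.hasSum_taylorSeries_of_entire hF 0 z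
  refine this.congr_fun ?_ |> fun h => h
  intro j
  simp only [tay, sub_zero, smul_eq_mul]
  ring

lemma ps_entire {ρ : ℕ → ℂ} (h : ∀ r : ℝ, 0 < r → ∃ B, ∀ j, ‖ρ j‖ * r ^ j ≤ B) :
    ∃ F : ℂ → ℂ, Differentiable ℂ F ∧ (∀ s, HasSum (fun j => ρ j * s ^ j) (F s)) ∧
      ∀ j, tay F j = ρ j := by
  set q := FormalMultilinearSeries.ofScalars ℂ ρ with hq
  have hrad : q.radius = ⊤ := by
    refine ENNReal.eq_top_of_forall_nnreal_le fun r => ?_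
    obtain ⟨B, hB⟩ := h (r + 1) (by positivity)
    refine q.le_radius_of_bound B fun n => ?_
    rw [hq, FormalMultilinearSeries.ofScalars_norm]
    refine le_trans ?_ (hB n)
    gcongr
    linarith
  have hs := q.hasFPowerSeriesOnBall (by rw [hrad]; exact ENNReal.zero_lt_top)
  refine ⟨q.sum, ?_, ?_, ?_⟩
  · intro z
    exact (hs.analyticAt_of_mem (by rw [hrad]; simp)).differentiableAt
  · intro s
    have := hs.hasSum (y := s) (by rw [hrad]; simp)
    simpa [hq, FormalMultilinearSeries.ofScalars_apply_eq, mul_comm] using this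
  · intro j
    have := hs.factorial_smul 1 j
    rw [tay, iteratedDeriv_eq_iteratedFDeriv, ← this, hq]
    have hj : (Nat.factorial j : ℂ) ≠ 0 := by exact_mod_cast Nat.factorial_ne_zero j
    have := FormalMultilinearSeries.ofScalars_apply_eq (E := ℂ) ρ 1 j
    rw [this]
    simp only [nsmul_eq_mul, one_pow, smul_eq_mul, mul_one]
    field_simp

/-- Cauchy estimates -/
lemma tay_bound {F : ℂ → ℂ} (hF : Differentiable ℂ F) {r B : ℝ} (hr : 0 < r)
    (hB : ∀ s : ℂ, ‖s‖ = r → ‖F s‖ ≤ B) (j : ℕ) : ‖tay F j‖ * r ^ j ≤ B := by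
  have := Complex.norm_iteratedDeriv_le_of_forall_mem_sphere_norm_le (c := 0) (R := r) (C := B) j hr
    hF.diffContOnCl (fun z hz => hB z (by simpa using hz))
  rw [tay, norm_div, Complex.norm_natCast]
  have hj : (0:ℝ) < Nat.factorial j := by exact_mod_cast Nat.factorial_pos j
  have hrj : 0 < r ^ j := by positivity
  rw [div_mul_eq_mul_div, div_le_iff₀ hj]
  rw [le_div_iff₀ hrj] at this
  linarith

def seqOp (ν : ℝ) (κ : ℂ) (ρ : ℕ → ℂ) : ℕ → ℂ := fun j =>
  (j + 1) * (2 * j + 2 * ν + 2) * ρ (j + 1) - κ * (j * (j + 2 * ν + 1)) * ρ j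

def Lop (ν : ℝ) (F : ℂ → ℂ) : ℂ → ℂ := fun s =>
  2 * (s * deriv (deriv F) s) + (2 * ν + 2) * deriv F s

lemma diff_deriv {F : ℂ → ℂ} (hF : Differentiable ℂ F) : Differentiable ℂ (deriv F) :=
  ((hF.contDiff (n := 2)).differentiable_deriv_two)

lemma Lop_diff (ν : ℝ) {F : ℂ → ℂ} (hF : Differentiable ℂ F) : Differentiable ℂ (Lop ν F) := by
  have h1 := diff_deriv hF
  have h2 := diff_deriv h1
  unfold Lop
  fun_prop

lemma diff_iteratedDeriv {F : ℂ → ℂ} (hF : Differentiable ℂ F) (j : ℕ) :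
    Differentiable ℂ (iteratedDeriv j F) := by
  induction j with
  | zero => simpa using hF
  | succ j ih => rw [iteratedDeriv_succ]; exact diff_deriv ih

lemma iteratedDeriv_id_mul {G : ℂ → ℂ} (hG : Differentiable ℂ G) (j : ℕ) :
    iteratedDeriv (j + 1) (fun s => s * G s) =
      fun s => s * iteratedDeriv (j + 1) G s + (j + 1) * iteratedDeriv j G s := by
  induction j with
  | zero =>
    funext s
    simp only [zero_add, iteratedDeriv_one, iteratedDeriv_zero]
    rw [deriv_fun_mul differentiableAt_fun_id (hG s)]
    simp; ring
  | succ j ih =>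
    rw [iteratedDeriv_succ, ih]
    funext s
    have h1 := diff_iteratedDeriv hG (j + 1)
    have h0 := diff_iteratedDeriv hG j
    rw [deriv_fun_add (by fun_prop) (by fun_prop), deriv_fun_mul differentiableAt_fun_id (h1 s),
      deriv_const_mul _ (h0 s), ← iteratedDeriv_succ, ← iteratedDeriv_succ]
    simp; ring

lemma tay_Lop (ν : ℝ) {F : ℂ → ℂ} (hF : Differentiable ℂ F) :
    tay (Lop ν F) = seqOp ν 0 (tay F) := by
  have h1 := diff_deriv hF
  have h2 := diff_deriv h1
  have key : ∀ j, iteratedDeriv j (fun s => s * deriv (deriv F) s) 0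
      = j * iteratedDeriv (j + 1) F 0 := by
    intro j
    cases j with
    | zero => simp
    | succ j =>
      rw [iteratedDeriv_id_mul h2]
      simp only [iteratedDeriv_succ']
      push_cast; ring
  funext j
  have hfac : (Nat.factorial j : ℂ) ≠ 0 := by exact_mod_cast Nat.factorial_ne_zero j
  have hfac' : ((j:ℂ) + 1) ≠ 0 := by exact_mod_cast Nat.succ_ne_zero j
  have hL : iteratedDeriv j (Lop ν F) 0 =
      2 * (j * iteratedDeriv (j + 1) F 0) + (2 * ν + 2) * iteratedDeriv (j + 1) F 0 := by
    unfold Lop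
    have c1 : ContDiff ℂ j (fun s => s * deriv (deriv F) s) := by
      have : Differentiable ℂ (fun s => s * deriv (deriv F) s) := by fun_prop
      exact this.contDiff
    have c2 : ContDiff ℂ j (deriv F) := h1.contDiff
    rw [iteratedDeriv_fun_add (contDiff_const.mul c1).contDiffAt
      (contDiff_const.mul c2).contDiffAt, iteratedDeriv_const_mul_field,
      iteratedDeriv_const_mul_field, key, ← iteratedDeriv_succ']
  simp only [tay, seqOp, hL, Nat.factorial_succ]
  push_cast
  field_simp
  ring

lemma besselOp_comp (ν : ℝ) {F : ℂ → ℂ} (hF : Differentiable ℂ F) :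
    besselOp ν (fun z => F (z ^ 2 / 2)) = fun z => Lop ν F (z ^ 2 / 2) := by
  have hq : ∀ z : ℂ, HasDerivAt (fun z : ℂ => z ^ 2 / 2) z z := by
    intro z
    have := ((hasDerivAt_id z).pow 2).div_const 2
    simpa using this
  have h1 := diff_deriv hF
  have d1 : deriv (fun z => F (z ^ 2 / 2)) = fun z => deriv F (z ^ 2 / 2) * z := by
    funext z
    exact ((hF _).hasDerivAt.comp z (hq z)).deriv
  have d2 : deriv (deriv (fun z => F (z ^ 2 / 2))) =
      fun z => deriv (deriv F) (z ^ 2 / 2) * z * z + deriv F (z ^ 2 / 2) := by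
    rw [d1]
    funext z
    have := (((h1 _).hasDerivAt.comp z (hq z))).mul (hasDerivAt_id z)
    have h := this.deriv
    simp only [id, mul_one, Function.comp] at h
    exact h
  funext z
  unfold besselOp Lop
  rw [d2, d1]
  by_cases hz : z = 0
  · simp [hz]
  · simp only [hz, if_false]
    field_simp
    ring

lemma besselOp_iter (ν : ℝ) (N : ℕ) {F : ℂ → ℂ} (hF : Differentiable ℂ F) :
    (besselOp ν)^[N] (fun z => F (z ^ 2 / 2)) 0 = (seqOp ν 0)^[N] (tay F) 0 := by
  induction N generalizing F with
  | zero => simp [tay]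
  | succ N ih =>
    rw [Function.iterate_succ_apply, Function.iterate_succ_apply, besselOp_comp ν hF,
      ih (Lop_diff ν hF), tay_Lop ν hF]

lemma even_rep {h : ℂ → ℂ} (hd : Differentiable ℂ h) (he : ∀ z, h (-z) = h z) :
    ∃ H : ℂ → ℂ, Differentiable ℂ H ∧ ∀ z, h z = H (z ^ 2 / 2) := by
  have hodd : ∀ j, tay h (2 * j + 1) = 0 := by
    intro j
    have h1 : (fun z => h (-z)) = h := funext he
    have h2 := iteratedDeriv_comp_neg (2 * j + 1) h 0
    rw [h1] at h2
    have : iteratedDeriv (2 * j + 1) h 0 = 0 := by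
      have h3 : (-1 : ℂ) ^ (2 * j + 1) = -1 := by rw [pow_succ, pow_mul]; simp
      rw [neg_zero, smul_eq_mul, h3] at h2
      have : (2:ℂ) * iteratedDeriv (2 * j + 1) h 0 = 0 := by linear_combination h2
      simpa using this
    simp [tay, this]
  obtain ⟨H, hH, hs, -⟩ := ps_entire (ρ := fun j => tay h (2 * j) * 2 ^ j) (by
    intro r hr
    have hc : ContinuousOn h (Metric.sphere 0 (Real.sqrt (2 * r))) := hd.continuous.continuousOn
    obtain ⟨B, hB⟩ := (isCompact_sphere _ _).exists_bound_of_continuousOn hc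
    refine ⟨B, fun j => ?_⟩
    have := tay_bound hd (r := Real.sqrt (2 * r)) (by positivity)
      (fun s hs => hB s (by simpa using hs)) (2 * j)
    rw [pow_mul, Real.sq_sqrt (by positivity), mul_pow] at this
    rw [norm_mul, norm_pow, Complex.norm_ofNat]
    linarith)
  refine ⟨H, hH, fun z => ?_⟩
  have h1 := hasSum_tay hd z
  have h2 := hs (z ^ 2 / 2)
  have h3 : HasSum (fun j => tay h (2 * j) * z ^ (2 * j)) (H (z ^ 2 / 2)) := by
    convert h2 using 2 with j
    rw [pow_mul, div_pow]; field_simp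
  have h4 : HasSum (fun j => tay h (2 * j + 1) * z ^ (2 * j + 1)) 0 := by
    simp only [hodd, zero_mul]; exact hasSum_zero
  have h5 := HasSum.even_add_odd (f := fun j => tay h j * z ^ j) h3 h4
  rw [add_zero] at h5
  exact h1.unique h5

/-- the rescaled polynomial `R(1 - κ s)` -/
def scaled (κ : ℂ) (R : Polynomial ℂ) : Polynomial ℂ := R.comp (1 - C κ * X)

lemma coeff_gegen (ν : ℝ) {κ : ℂ} (hκ : κ ≠ 0) (R : Polynomial ℂ) :
    (scaled κ (gegenOp (ν + 1/2) R)).coeff = κ⁻¹ • seqOp ν κ (scaled κ R).coeff := by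
  have d1 : derivative (scaled κ R) = (derivative R).comp (1 - C κ * X) * (- C κ) := by
    simp [scaled, derivative_comp]
    ring
  have d2 : derivative (derivative (scaled κ R)) =
      (derivative (derivative R)).comp (1 - C κ * X) * (C κ * C κ) := by
    rw [d1]
    simp [derivative_comp]
    ring
  have key : C κ * scaled κ (gegenOp (ν + 1/2) R) =
      C 2 * (X * derivative (derivative (scaled κ R)))
        - C κ * (X * (X * derivative (derivative (scaled κ R))))
      + C ((2 * ν + 2 : ℝ) : ℂ) * derivative (scaled κ R)
      - C (κ * ((2 * ν + 2 : ℝ) : ℂ)) * (X * derivative (scaled κ R)) := by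
    rw [d2, d1]
    have e : ((2 * (ν + 1/2) + 1 : ℝ) : ℂ) = ((2 * ν + 2 : ℝ) : ℂ) := by
      congr 1; ring
    simp only [scaled, gegenOp, e]
    simp only [sub_comp, mul_comp, one_comp, pow_comp, X_comp, C_comp, C_mul, map_ofNat]
    ring
  funext j
  have h := congrArg (fun P => Polynomial.coeff P j) key
  simp only [coeff_C_mul, coeff_add, coeff_sub] at h
  rw [Pi.smul_apply, smul_eq_mul, eq_inv_mul_iff_mul_eq₀ hκ, h]
  unfold seqOp
  rcases j with _ | _ | j
  · simp [coeff_derivative]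
  · simp [coeff_derivative, coeff_X_mul]
    ring
  · simp [coeff_derivative, coeff_X_mul]
    ring

lemma seqOp_smul (ν : ℝ) (κ c : ℂ) (ρ : ℕ → ℂ) : seqOp ν κ (c • ρ) = c • seqOp ν κ ρ := by
  funext j
  simp only [seqOp, Pi.smul_apply, smul_eq_mul]
  ring

lemma coeff_gegen_iter (ν : ℝ) {κ : ℂ} (hκ : κ ≠ 0) (R : Polynomial ℂ) (N : ℕ) :
    (scaled κ ((gegenOp (ν + 1/2))^[N] R)).coeff =
      (κ⁻¹) ^ N • (seqOp ν κ)^[N] (scaled κ R).coeff := by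
  induction N with
  | zero => simp
  | succ N ih =>
    rw [Function.iterate_succ_apply', coeff_gegen ν hκ, ih, seqOp_smul,
      Function.iterate_succ_apply', smul_smul, pow_succ, mul_comm]

lemma gegen_eval_one (ν : ℝ) (N n : ℕ) (hn : 0 < n) (R : Polynomial ℂ) :
    ((gegenOp (ν + 1/2))^[N] R).eval 1 =
      (n : ℂ) ^ (2 * N) * (seqOp ν (1 / (n:ℂ) ^ 2))^[N] (scaled (1 / (n:ℂ) ^ 2) R).coeff 0 := by
  have hn' : (n:ℂ) ≠ 0 := by exact_mod_cast hn.ne'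
  have h := congrFun (coeff_gegen_iter ν (κ := 1 / (n:ℂ) ^ 2) (one_div_ne_zero (pow_ne_zero 2 hn')) R N) 0
  rw [Pi.smul_apply, smul_eq_mul] at h
  have h2 : (scaled (1 / (n:ℂ) ^ 2) ((gegenOp (ν + 1/2))^[N] R)).coeff 0 =
      ((gegenOp (ν + 1/2))^[N] R).eval 1 := by
    rw [coeff_zero_eq_eval_zero]
    simp [scaled, eval_comp]
  rw [h2] at h
  rw [h]
  congr 1
  rw [pow_mul]; simp

lemma seqOp_tendsto (ν : ℝ) {κ : ℕ → ℂ} (hκ : Tendsto κ atTop (𝓝 0)) (N : ℕ)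
    {ρ : ℕ → ℕ → ℂ} {ρ' : ℕ → ℂ} (h : ∀ j, Tendsto (fun k => ρ k j) atTop (𝓝 (ρ' j))) (j : ℕ) :
    Tendsto (fun k => (seqOp ν (κ k))^[N] (ρ k) j) atTop (𝓝 ((seqOp ν 0)^[N] ρ' j)) := by
  induction N generalizing j with
  | zero => simpa using h j
  | succ N ih =>
    simp only [Function.iterate_succ_apply']
    exact ((ih (j + 1)).const_mul _).sub ((hκ.mul_const _).mul (ih j))

lemma seqOp_iter_zero (ν : ℝ) (N : ℕ) : ∃ c : ℕ → ℂ, ∀ (ρ : ℕ → ℂ) (j : ℕ),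
    (seqOp ν 0)^[N] ρ j = c j * ρ (j + N) := by
  induction N with
  | zero => exact ⟨1, fun ρ j => by simp⟩
  | succ N ih =>
    obtain ⟨c, hc⟩ := ih
    refine ⟨fun j => (j + 1) * (2 * j + 2 * ν + 2) * c (j + 1), fun ρ j => ?_⟩
    rw [Function.iterate_succ_apply']
    have : j + 1 + N = j + (N + 1) := by ring
    simp only [seqOp, hc, this]
    ring

/-- growth of the rescaled polynomial -/
lemma scaled_bound {n : ℕ} (hn : 0 < n) {R : Polynomial ℂ} (hR : R.natDegree ≤ n) {M : ℝ}
    (hM : ∀ t ∈ Set.Icc (-1:ℝ) 1, ‖R.eval (t:ℂ)‖ ≤ M) (s : ℂ) :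
    ‖(scaled (1 / (n:ℂ) ^ 2) R).eval s‖ ≤ M * Real.exp (Real.sqrt (2 * ‖s‖)) := by
  have hM0 : 0 ≤ M := (norm_nonneg _).trans (hM 0 ⟨by norm_num, by norm_num⟩)
  have hn' : (n:ℂ) ≠ 0 := by exact_mod_cast hn.ne'
  have hnr : (0:ℝ) < n := by exact_mod_cast hn
  obtain ⟨w, hw⟩ := Complex.cos_surjective (1 - 1 / (n:ℂ) ^ 2 * s)
  have h1 : (scaled (1 / (n:ℂ) ^ 2) R).eval s = R.eval (Complex.cos ((n * w) / n)) := by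
    rw [mul_div_cancel_left₀ _ hn', hw]
    simp [scaled, eval_comp]
  rw [h1]
  refine (poly_cos_bound hn hR hM _).trans ?_
  gcongr
  apply Real.le_sqrt_of_sq_le
  rw [sq_abs]
  have him : ((n:ℂ) * w).im = n * w.im := by simp
  rw [him]
  -- s = 2 n^2 sin^2(w/2)
  have hs : s = 2 * (n:ℂ) ^ 2 * Complex.sin (w / 2) ^ 2 := by
    have h2 : Complex.cos w = 1 - 2 * Complex.sin (w / 2) ^ 2 := by
      have := Complex.cos_two_mul (w / 2)
      rw [mul_div_cancel₀ _ two_ne_zero] at this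
      rw [this, Complex.cos_sq']; ring
    rw [h2] at hw
    field_simp at hw
    linear_combination hw
  have hsin : (w.im / 2) ^ 2 ≤ ‖Complex.sin (w / 2)‖ ^ 2 := by
    set u := w / 2 with hu
    have hui : u.im = w.im / 2 := by simp [hu]
    rw [← hui, Complex.sq_norm, Complex.normSq_apply]
    have e : Complex.sin u = ((Real.sin u.re * Real.cosh u.im : ℝ) : ℂ)
        + ((Real.cos u.re * Real.sinh u.im : ℝ) : ℂ) * Complex.I := by
      rw [Complex.sin_eq]; push_cast; rfl
    have hre : (Complex.sin u).re = Real.sin u.re * Real.cosh u.im := by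
      rw [e, Complex.add_re, Complex.ofReal_re, Complex.re_ofReal_mul, Complex.I_re]; ring
    have himm : (Complex.sin u).im = Real.cos u.re * Real.sinh u.im := by
      rw [e, Complex.add_im, Complex.ofReal_im, Complex.im_ofReal_mul, Complex.I_im]; ring
    rw [hre, himm]
    have c1 := Real.cosh_sq u.im
    have c2 := Real.sin_sq_add_cos_sq u.re
    have c3 : u.im ^ 2 ≤ Real.sinh u.im ^ 2 := by
      rw [sq_le_sq, Real.abs_sinh]
      exact Real.self_le_sinh_iff.2 (abs_nonneg _)
    have c4 : Real.sin u.re * Real.cosh u.im * (Real.sin u.re * Real.cosh u.im) +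
        Real.cos u.re * Real.sinh u.im * (Real.cos u.re * Real.sinh u.im)
        = Real.sin u.re ^ 2 + Real.sinh u.im ^ 2 := by
      have : Real.cos u.re ^ 2 = 1 - Real.sin u.re ^ 2 := by linarith
      calc _ = Real.sin u.re ^ 2 * Real.cosh u.im ^ 2 + Real.cos u.re ^ 2 * Real.sinh u.im ^ 2 := by ring
        _ = _ := by rw [c1, this]; ring
    rw [c4]
    nlinarith [sq_nonneg (Real.sin u.re)]
  have hns : ‖s‖ = 2 * (n:ℝ) ^ 2 * ‖Complex.sin (w / 2)‖ ^ 2 := by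
    rw [hs]; simp
  rw [hns]
  have : (0:ℝ) ≤ (n:ℝ) ^ 2 := by positivity
  nlinarith

lemma sin_scale {a : ℕ → ℝ} (ha : Tendsto a atTop atTop) (x : ℝ) :
    Tendsto (fun k => a k * Real.sin (x / a k)) atTop (𝓝 x) := by
  have h1 : Tendsto (fun k => x * Real.sinc (x / a k)) atTop (𝓝 (x * Real.sinc 0)) := by
    refine Tendsto.const_mul _ ?_
    exact (Real.continuous_sinc.tendsto 0).comp (ha.const_div_atTop x)
  rw [Real.sinc_zero, mul_one] at h1
  refine h1.congr' ?_
  filter_upwards [ha.eventually_gt_atTop 0] with k hk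
  by_cases hx : x = 0
  · simp [hx]
  · rw [Real.sinc_of_ne_zero (div_ne_zero hx hk.ne')]
    field_simp

lemma hasSum_poly (P : Polynomial ℂ) (s : ℂ) : HasSum (fun j => P.coeff j * s ^ j) (P.eval s) := by
  rw [Polynomial.eval_eq_sum_range]
  apply hasSum_sum_of_ne_finset_zero
  intro j hj
  rw [Polynomial.coeff_eq_zero_of_natDegree_lt, zero_mul]
  simpa using hj

lemma tay_poly (P : Polynomial ℂ) (j : ℕ) : tay (fun s => P.eval s) j = P.coeff j := by
  obtain ⟨F, hF, hs, ht⟩ := ps_entire (ρ := P.coeff) (by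
    intro r hr
    refine ⟨∑ i ∈ Finset.range (P.natDegree + 1), ‖P.coeff i‖ * r ^ i, fun j => ?_⟩
    by_cases hj : j ∈ Finset.range (P.natDegree + 1)
    · exact Finset.single_le_sum (f := fun i => ‖P.coeff i‖ * r ^ i)
        (fun i _ => by positivity) hj
    · rw [Polynomial.coeff_eq_zero_of_natDegree_lt (by simpa using hj)]
      simp only [norm_zero, zero_mul]
      exact Finset.sum_nonneg fun i _ => by positivity)
  rw [← ht j]
  congr 1
  funext s
  exact (hasSum_poly P s).unique (hs s)

lemma one_sub_cos_eq (n : ℝ) (hn : n ≠ 0) (x : ℝ) :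
    n ^ 2 * (1 - Real.cos (x / n)) = (2 * n * Real.sin (x / (2 * n))) ^ 2 / 2 := by
  have h2 : Real.cos (x / n) = 1 - 2 * Real.sin (x / (2 * n)) ^ 2 := by
    have := Real.cos_two_mul (x / (2 * n))
    have e : 2 * (x / (2 * n)) = x / n := by field_simp
    rw [e] at this
    rw [this, Real.cos_sq']; ring
  rw [h2]; ring

lemma compactness {M : ℝ} {n : ℕ → ℕ} (hn : Tendsto n atTop atTop) (hpos : ∀ k, 0 < n k)
    {R : ℕ → Polynomial ℂ} (hdeg : ∀ k, (R k).natDegree ≤ n k)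
    (hM : ∀ k, ∀ t ∈ Set.Icc (-1:ℝ) 1, ‖(R k).eval (t:ℂ)‖ ≤ M) :
    ∃ (φ : ℕ → ℕ) (F : ℂ → ℂ), StrictMono φ ∧ Differentiable ℂ F ∧
      (∀ z : ℂ, ‖F (z ^ 2 / 2)‖ ≤ M * Real.exp ‖z‖) ∧
      (∀ x : ℝ, Tendsto (fun k => (R (φ k)).eval ((Real.cos (x / n (φ k)) : ℝ) : ℂ)) atTop
        (𝓝 (F ((x:ℂ) ^ 2 / 2)))) ∧
      ∀ (ν : ℝ) (N : ℕ), Tendsto (fun k => (seqOp ν (1 / (n (φ k) : ℂ) ^ 2))^[N]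
        (scaled (1 / (n (φ k) : ℂ) ^ 2) (R (φ k))).coeff 0) atTop
        (𝓝 ((besselOp ν)^[N] (fun z => F (z ^ 2 / 2)) 0)) := by
  set P : ℕ → Polynomial ℂ := fun k => scaled (1 / (n k : ℂ) ^ 2) (R k) with hP
  have hM0 : 0 ≤ M := (norm_nonneg _).trans (hM 0 0 ⟨by norm_num, by norm_num⟩)
  have hcb : ∀ k, ∀ r : ℝ, 0 < r → ∀ j,
      ‖(P k).coeff j‖ * r ^ j ≤ M * Real.exp (Real.sqrt (2 * r)) := by
    intro k r hr j
    rw [← tay_poly]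
    refine tay_bound (Polynomial.differentiable _) hr (fun s hs => ?_) j
    have := scaled_bound (hpos k) (hdeg k) (hM k) s
    rw [hs] at this
    exact this
  -- compactness of coefficients
  have hcomp : IsCompact (Set.pi Set.univ
      (fun _ : ℕ => Metric.closedBall (0:ℂ) (M * Real.exp (Real.sqrt (2 * 1))))) :=
    isCompact_univ_pi fun _ => isCompact_closedBall _ _
  obtain ⟨ρ, -, φ, hφ, hlim⟩ := hcomp.tendsto_subseq (x := fun k => (P k).coeff) (by
    intro k j _
    have := hcb k 1 one_pos j
    simpa using this)
  rw [tendsto_pi_nhds] at hlim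
  have hρ : ∀ r : ℝ, 0 < r → ∀ j, ‖ρ j‖ * r ^ j ≤ M * Real.exp (Real.sqrt (2 * r)) := by
    intro r hr j
    exact le_of_tendsto ((hlim j).norm.mul_const _) (Eventually.of_forall fun k => hcb _ r hr j)
  obtain ⟨F, hF, hFs, hFt⟩ := ps_entire (ρ := ρ) fun r hr => ⟨_, hρ r hr⟩
  -- continuous convergence
  have hconv : ∀ (s : ℕ → ℂ) (s' : ℂ), Tendsto s atTop (𝓝 s') →
      Tendsto (fun k => (P (φ k)).eval (s k)) atTop (𝓝 (F s')) := by
    intro s s' hs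
    set K : ℝ := ‖s'‖ + 1 with hK
    have hK0 : 0 < K := by positivity
    have hsb : ∀ᶠ k in atTop, ‖s k‖ ≤ K := by
      have := hs.norm.eventually (ge_mem_nhds (show ‖s'‖ < K by linarith))
      exact this
    have hb : Summable fun j : ℕ => M * Real.exp (Real.sqrt (2 * (2 * K))) * (1 / 2 : ℝ) ^ j :=
      (summable_geometric_of_lt_one (by norm_num) (by norm_num)).mul_left _
    have := tendsto_tsum_of_dominated_convergence (𝓕 := atTop)
      (f := fun k j => (P (φ k)).coeff j * s k ^ j) (g := fun j => ρ j * s' ^ j) hb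
      (fun j => (hlim j).mul (hs.pow j)) (by
        filter_upwards [hsb] with k hk j
        have h1 := hcb (φ k) (2 * K) (by positivity) j
        rw [norm_mul, norm_pow]
        calc _ ≤ ‖(P (φ k)).coeff j‖ * K ^ j := by gcongr
          _ = (‖(P (φ k)).coeff j‖ * (2 * K) ^ j) * (1 / 2) ^ j := by
            rw [mul_assoc, ← mul_pow]; congr 2; ring
          _ ≤ _ := by gcongr)
    rw [(hFs s').tsum_eq] at this
    refine this.congr fun k => ?_
    exact (hasSum_poly _ _).tsum_eq
  have hnφ : Tendsto (fun k => (n (φ k) : ℝ)) atTop atTop :=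
    tendsto_natCast_atTop_atTop.comp (hn.comp hφ.tendsto_atTop)
  refine ⟨φ, F, hφ, hF, ?_, ?_, ?_⟩
  · intro z
    refine le_of_tendsto (hconv (fun _ => z ^ 2 / 2) _ tendsto_const_nhds).norm
      (Eventually.of_forall fun k => ?_)
    refine (scaled_bound (hpos _) (hdeg _) (hM _) _).trans (le_of_eq ?_)
    have : 2 * ‖z ^ 2 / 2‖ = ‖z‖ ^ 2 := by
      rw [norm_div, norm_pow, Complex.norm_ofNat]; ring
    rw [this, Real.sqrt_sq (norm_nonneg _)]
  · intro x
    have h1 : Tendsto (fun k => ((2 * (n (φ k) : ℝ) * Real.sin (x / (2 * n (φ k)))) ^ 2 / 2))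
        atTop (𝓝 (x ^ 2 / 2)) :=
      ((sin_scale (hnφ.const_mul_atTop two_pos) x).pow 2).div_const 2
    have h2 := hconv (fun k => (((2 * (n (φ k) : ℝ) * Real.sin (x / (2 * n (φ k)))) ^ 2 / 2 : ℝ) : ℂ))
      ((x ^ 2 / 2 : ℝ) : ℂ) ((Complex.continuous_ofReal.tendsto _).comp h1)
    rw [show (x:ℂ) ^ 2 / 2 = ((x ^ 2 / 2 : ℝ) : ℂ) by push_cast; ring]
    refine h2.congr fun k => ?_
    have hk : (n (φ k) : ℝ) ≠ 0 := by exact_mod_cast (hpos _).ne'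
    rw [← one_sub_cos_eq _ hk]
    simp only [hP, scaled, eval_comp]
    congr 1
    have hk' : (n (φ k) : ℂ) ≠ 0 := by exact_mod_cast (hpos _).ne'
    simp only [eval_sub, eval_one, eval_mul, eval_C, eval_X]
    push_cast
    field_simp
    ring
  · intro ν N
    rw [besselOp_iter ν N hF]
    refine seqOp_tendsto ν ?_ N (fun j => ?_) 0
    · have h1 : Tendsto (fun k => ((1 / (n (φ k) : ℝ) ^ 2 : ℝ) : ℂ)) atTop (𝓝 ((0:ℝ) : ℂ)) := by
        refine (Complex.continuous_ofReal.tendsto _).comp ?_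
        simp only [one_div]
        exact ((tendsto_pow_atTop two_ne_zero).comp hnφ).inv_tendsto_atTop
      simpa using h1
    · rw [hFt j]; exact hlim j

/-- the half-line version of the weighted measure for polynomials -/
def muN (ν : ℝ) (n : ℕ) : Measure ℝ :=
  (volume.restrict (Set.Ioo (0:ℝ) (n * Real.pi))).withDensity
    fun x => ENNReal.ofReal ((n * Real.sin (x / n)) ^ (2 * ν + 1))

/-- the half-line version of the weighted measure -/
def muI (ν : ℝ) : Measure ℝ :=
  (volume.restrict (Set.Ioi (0:ℝ))).withDensity fun x => ENNReal.ofReal (x ^ (2 * ν + 1))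

/-- the weighted measure on the segment -/
def muP (ν : ℝ) : Measure ℝ :=
  (volume.restrict (Set.Icc (-1 : ℝ) 1)).withDensity
          fun t => ENNReal.ofReal ((1 - t ^ 2) ^ ν)

lemma sin_div_pos {n : ℕ} (hn : 0 < n) {x : ℝ} (hx : x ∈ Set.Ioo (0:ℝ) (n * Real.pi)) :
    0 < Real.sin (x / n) := by
  have hn' : (0:ℝ) < n := by exact_mod_cast hn
  apply Real.sin_pos_of_pos_of_lt_pi (div_pos hx.1 hn')
  rw [div_lt_iff₀ hn', mul_comm]; exact hx.2

lemma weight_id {ν : ℝ} {n : ℕ} (hn : 0 < n) {x : ℝ} (hx : x ∈ Set.Ioo (0:ℝ) (n * Real.pi)) :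
    |(-Real.sin (x / n) * (1 / n))| * (1 - Real.cos (x / n) ^ 2) ^ ν
      = (n:ℝ) ^ (-(2 * ν + 2)) * (n * Real.sin (x / n)) ^ (2 * ν + 1) := by
  have hn' : (0:ℝ) < n := by exact_mod_cast hn
  have hs := sin_div_pos hn hx
  set s := Real.sin (x / n) with hsdef
  have h1 : 1 - Real.cos (x / n) ^ 2 = s ^ (2:ℝ) := by
    rw [hsdef, Real.rpow_two]; nlinarith [Real.sin_sq_add_cos_sq (x / n)]
  rw [h1, ← Real.rpow_mul hs.le, Real.mul_rpow hn'.le hs.le, abs_mul, abs_neg, abs_of_pos hs,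
    abs_of_pos (by positivity : (0:ℝ) < 1 / n), Real.rpow_add_one hs.ne', Real.rpow_add_one hn'.ne',
    Real.rpow_neg hn'.le, show 2 * ν + 2 = 2 * ν + 1 + 1 by ring, Real.rpow_add_one hn'.ne' (2*ν+1),
    Real.rpow_add_one hn'.ne' (2*ν)]
  have : (n:ℝ) ^ (2 * ν) ≠ 0 := (Real.rpow_pos_of_pos hn' _).ne'
  field_simp

lemma muP_eq (ν : ℝ) {n : ℕ} (hn : 0 < n) :
    muP ν = ENNReal.ofReal ((n:ℝ) ^ (-(2 * ν + 2))) •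
      Measure.map (fun x : ℝ => Real.cos (x / n)) (muN ν n) := by
  have hn' : (0:ℝ) < n := by exact_mod_cast hn
  apply Measure.ext_of_lintegral
  intro g hg
  rw [lintegral_smul_measure, lintegral_map hg (by fun_prop), muP, muN,
    lintegral_withDensity_eq_lintegral_mul _ (by fun_prop) hg,
    lintegral_withDensity_eq_lintegral_mul _ (by fun_prop) (by fun_prop)]
  have himg : (fun x : ℝ => Real.cos (x / n)) '' Set.Icc 0 (n * Real.pi) = Set.Icc (-1) 1 := by
    rw [← Real.bijOn_cos.image_eq]
    ext y; constructor
    · rintro ⟨x, hx, rfl⟩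
      refine ⟨x / n, ⟨div_nonneg hx.1 hn'.le, ?_⟩, rfl⟩
      rw [div_le_iff₀ hn', mul_comm]; exact hx.2
    · rintro ⟨x, hx, rfl⟩
      refine ⟨n * x, ⟨mul_nonneg hn'.le hx.1, ?_⟩, ?_⟩
      · exact mul_le_mul_of_nonneg_left hx.2 hn'.le
      · simp only; congr 1; field_simp
  have hinj : Set.InjOn (fun x : ℝ => Real.cos (x / n)) (Set.Icc 0 (n * Real.pi)) := by
    intro x hx y hy hxy
    have h := Real.bijOn_cos.injOn (x₁ := x / n) (x₂ := y / n)
      ⟨div_nonneg hx.1 hn'.le, by rw [div_le_iff₀ hn', mul_comm]; exact hx.2⟩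
      ⟨div_nonneg hy.1 hn'.le, by rw [div_le_iff₀ hn', mul_comm]; exact hy.2⟩ hxy
    field_simp at h
    exact h
  rw [← himg, lintegral_image_eq_lintegral_abs_deriv_mul
    (f' := fun x => -Real.sin (x / n) * (1 / n)) measurableSet_Icc _ hinj,
    ← Measure.restrict_congr_set Ioo_ae_eq_Icc, smul_eq_mul, ← lintegral_const_mul _ (by fun_prop)]
  · apply setLIntegral_congr_fun measurableSet_Ioo
    intro x hx
    have h := weight_id (ν := ν) hn hx
    simp only [Pi.mul_apply]
    rw [← mul_assoc, ← mul_assoc, ← ENNReal.ofReal_mul (abs_nonneg _), h,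
      ENNReal.ofReal_mul (by positivity)]
  · intro x hx
    apply HasDerivAt.hasDerivWithinAt
    exact (((hasDerivAt_id x).div_const (n:ℝ)).cos)

lemma eLpNorm_muP (ν : ℝ) {n : ℕ} (hn : 0 < n) (p : ℝ≥0∞) {g : ℝ → ℂ} (hg : Continuous g) :
    eLpNorm g p (muP ν) = ENNReal.ofReal ((n:ℝ) ^ (-(2 * ν + 2) / p.toReal)) *
      eLpNorm (fun x : ℝ => g (Real.cos (x / n))) p (muN ν n) := by
  have hn' : (0:ℝ) < n := by exact_mod_cast hn
  have h1 : (0:ℝ) < (n:ℝ) ^ (-(2 * ν + 2)) := by positivity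
  rw [muP_eq ν hn, eLpNorm_smul_measure_of_ne_zero (by simpa using h1),
    eLpNorm_map_measure hg.aestronglyMeasurable (by fun_prop), smul_eq_mul]
  congr 1
  rw [one_div, ENNReal.toReal_inv, ENNReal.ofReal_rpow_of_pos h1, ← Real.rpow_mul hn'.le]; rfl

lemma wMeasR_eq (ν : ℝ) : Measure.map (fun x : ℝ => |x|) (wMeasR ν) = (2:ℝ≥0∞) • muI ν := by
  apply Measure.ext_of_lintegral
  intro g hg
  rw [lintegral_smul_measure, lintegral_map hg (by fun_prop), wMeasR, muI,
    lintegral_withDensity_eq_lintegral_mul _ (by fun_prop) (by fun_prop),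
    lintegral_withDensity_eq_lintegral_mul _ (by fun_prop) hg]
  have h0 : ∀ G : ℝ → ℝ≥0∞, ∫⁻ x, G x = (∫⁻ x in Set.Ioi 0, G x) + ∫⁻ x in Set.Ioi 0, G (-x) := by
    intro G
    rw [← lintegral_add_compl G (measurableSet_Ioi (a := (0:ℝ)))]
    congr 1
    rw [Set.compl_Ioi, ← Measure.restrict_congr_set Iio_ae_eq_Iic]
    have := (Measure.measurePreserving_neg (volume : Measure ℝ)).setLIntegral_comp_preimage_emb
      (MeasurableEquiv.neg ℝ).measurableEmbedding G (Set.Iio 0)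
    rw [← this]; simp
  rw [h0]
  have h1 : ∀ x ∈ Set.Ioi (0:ℝ), ((fun t : ℝ => ENNReal.ofReal (|t| ^ (2 * ν + 1))) * fun a => g |a|) x
      = ((fun t : ℝ => ENNReal.ofReal (t ^ (2 * ν + 1))) * g) x := by
    intro x hx
    simp [abs_of_pos (Set.mem_Ioi.1 hx)]
  have h2 : ∀ x ∈ Set.Ioi (0:ℝ), ((fun t : ℝ => ENNReal.ofReal (|t| ^ (2 * ν + 1))) * fun a => g |a|) (-x)
      = ((fun t : ℝ => ENNReal.ofReal (t ^ (2 * ν + 1))) * g) x := by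
    intro x hx
    simp [abs_of_pos (Set.mem_Ioi.1 hx)]
  rw [setLIntegral_congr_fun measurableSet_Ioi h1, setLIntegral_congr_fun measurableSet_Ioi h2,
    smul_eq_mul]
  exact (two_mul _).symm

lemma eLpNorm_wMeasR (ν : ℝ) (p : ℝ≥0∞) {f : ℝ → ℂ} (hf : Continuous f) (he : ∀ x, f (-x) = f x) :
    eLpNorm f p (wMeasR ν) = ENNReal.ofReal ((2:ℝ) ^ (1 / p.toReal)) * eLpNorm f p (muI ν) := by
  have h1 : f = f ∘ (fun x : ℝ => |x|) := by
    funext x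
    rcases abs_choice x with h | h <;> simp [h, he]
  conv_lhs => rw [h1]
  rw [← eLpNorm_map_measure hf.aestronglyMeasurable (by fun_prop), wMeasR_eq,
    eLpNorm_smul_measure_of_ne_zero (by simp), smul_eq_mul]
  congr 1
  rw [one_div, ENNReal.toReal_inv, one_div, ← ENNReal.ofReal_rpow_of_pos (by norm_num)]
  simp

lemma eLpNorm_dilate (ν : ℝ) (p : ℝ≥0∞) {f : ℝ → ℂ} (hf : Continuous f) {τ : ℝ} (hτ : 0 < τ) :
    eLpNorm (fun x => f (τ * x)) p (wMeasR ν) =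
      ENNReal.ofReal (τ ^ (-(2 * ν + 2) / p.toReal)) * eLpNorm f p (wMeasR ν) := by
  have h1 : (0:ℝ) < τ ^ (-(2 * ν + 2)) := by positivity
  have key : Measure.map (fun x : ℝ => τ * x) (wMeasR ν)
      = ENNReal.ofReal (τ ^ (-(2 * ν + 2))) • wMeasR ν := by
    apply Measure.ext_of_lintegral
    intro g hg
    rw [lintegral_smul_measure, lintegral_map hg (by fun_prop), wMeasR,
      lintegral_withDensity_eq_lintegral_mul _ (by fun_prop) (by fun_prop),
      lintegral_withDensity_eq_lintegral_mul _ (by fun_prop) hg]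
    have h2 : ∀ x : ℝ, ((fun t : ℝ => ENNReal.ofReal (|t| ^ (2 * ν + 1))) * fun a => g (τ * a)) x
      = ENNReal.ofReal (τ ^ (-(2 * ν + 1))) *
        ((fun t : ℝ => ENNReal.ofReal (|t| ^ (2 * ν + 1))) * g) (τ * x) := by
      intro x
      simp only [Pi.mul_apply]
      rw [← mul_assoc, ← ENNReal.ofReal_mul (by positivity), abs_mul, abs_of_pos hτ,
        Real.mul_rpow hτ.le (abs_nonneg _), ← mul_assoc, ← Real.rpow_add hτ]
      simp
    simp_rw [h2]
    rw [lintegral_const_mul _ (by fun_prop),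
      ← lintegral_map (f := ((fun t : ℝ => ENNReal.ofReal (|t| ^ (2 * ν + 1))) * g))
        (by fun_prop) (by fun_prop : Measurable fun x : ℝ => τ * x), Real.map_volume_mul_left hτ.ne',
      lintegral_smul_measure, smul_eq_mul, smul_eq_mul, ← mul_assoc,
      ← ENNReal.ofReal_mul (by positivity), abs_of_pos (by positivity), ← Real.rpow_neg_one,
      ← Real.rpow_add hτ]
    congr 3; ring
  have h3 := eLpNorm_map_measure (p := p) (μ := wMeasR ν) (f := fun x : ℝ => τ * x) (g := f)
    hf.aestronglyMeasurable (by fun_prop)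
  rw [key, eLpNorm_smul_measure_of_ne_zero (by simpa using h1), smul_eq_mul] at h3
  rw [show (fun x => f (τ * x)) = f ∘ (fun x : ℝ => τ * x) from rfl, ← h3]
  congr 1
  rw [one_div, ENNReal.toReal_inv, ENNReal.ofReal_rpow_of_pos h1, ← Real.rpow_mul hτ.le]; rfl

/-- the renormalised functional -/
def xval (ν : ℝ) (N n : ℕ) (R : Polynomial ℂ) : ℂ :=
  (seqOp ν (1/(n:ℂ)^2))^[N] (scaled (1/(n:ℂ)^2) R).coeff 0

/-- the renormalised norm -/
def ynorm (ν : ℝ) (p : ℝ≥0∞) (n : ℕ) (R : Polynomial ℂ) : ℝ≥0∞ :=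
  eLpNorm (fun x : ℝ => R.eval ((Real.cos (x / n) : ℝ) : ℂ)) p (muN ν n)

lemma a_eq (ν : ℝ) (N : ℕ) (p : ℝ≥0∞) {n : ℕ} (hn : 0 < n) :
    ENNReal.ofReal ((n : ℝ) ^ (-(2 * (N : ℝ)) - (2 * ν + 2) / p.toReal)) * gegenPolyConst ν N p n
    = ⨆ (R : Polynomial ℂ) (_ : R.natDegree ≤ n ∧ R ≠ 0), ‖xval ν N n R‖ₑ / ynorm ν p n R := by
  have hn' : (0:ℝ) < n := by exact_mod_cast hn
  rw [gegenPolyConst, ENNReal.mul_iSup]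
  refine iSup_congr fun R => ?_
  rw [ENNReal.mul_iSup]
  refine iSup_congr fun hR => ?_
  have h1 := eLpNorm_muP ν hn p (g := fun t : ℝ => R.eval (t : ℂ)) (by fun_prop)
  rw [muP] at h1
  rw [h1, gegen_eval_one ν N n hn R]
  change _ * (‖_ * xval ν N n R‖ₑ / (_ * ynorm ν p n R)) = _
  rw [enorm_mul]
  have h2 : ‖(n:ℂ) ^ (2 * N)‖ₑ = ENNReal.ofReal ((n:ℝ) ^ (2 * (N:ℝ))) := by
    rw [← ofReal_norm, norm_pow, Complex.norm_natCast]
    congr 1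
    rw [← Real.rpow_natCast]; push_cast; rfl
  rw [h2]
  set A := -(2 * ν + 2) / p.toReal with hA
  have h3 : ENNReal.ofReal ((n : ℝ) ^ (-(2 * (N : ℝ)) - (2 * ν + 2) / p.toReal)) *
      ENNReal.ofReal ((n:ℝ) ^ (2 * (N:ℝ))) = ENNReal.ofReal ((n:ℝ) ^ A) := by
    rw [← ENNReal.ofReal_mul (by positivity), ← Real.rpow_add hn']
    congr 2; rw [hA]; ring
  rw [← mul_div_assoc, ← mul_assoc, h3]
  exact ENNReal.mul_div_mul_left _ _ (by simpa using (by positivity : (0:ℝ) < (n:ℝ) ^ A)) (by simp)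

lemma sin_lower {n : ℕ} (hn : 0 < n) {x d : ℝ} (hd : 0 ≤ d) (h1 : d ≤ x) (h2 : x ≤ n * Real.pi - d) :
    2 / Real.pi * d ≤ n * Real.sin (x / n) := by
  have hn' : (0:ℝ) < n := by exact_mod_cast hn
  have hpi := Real.pi_pos
  rcases le_total (x / n) (Real.pi / 2) with h | h
  · have h3 := Real.mul_le_sin (div_nonneg (hd.trans h1) hn'.le) h
    calc 2 / Real.pi * d ≤ 2 / Real.pi * x := by gcongr
      _ = n * (2 / Real.pi * (x / n)) := by field_simp
      _ ≤ _ := by gcongr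
  · have h0 : x / n ≤ Real.pi := by rw [div_le_iff₀ hn']; linarith
    have h3 := Real.mul_le_sin (x := Real.pi - x / n) (by linarith) (by linarith)
    rw [Real.sin_pi_sub] at h3
    calc 2 / Real.pi * d ≤ 2 / Real.pi * (n * Real.pi - x) := by gcongr; linarith
      _ = n * (2 / Real.pi * (Real.pi - x / n)) := by field_simp
      _ ≤ _ := by gcongr

lemma nikolskii_aux {ν : ℝ} (hν : -(1/2 : ℝ) ≤ ν) {n : ℕ} (hn : 0 < n) {a : ℝ}
    (h1 : 1/12 ≤ a) (h2 : a + 1/12 ≤ n * Real.pi - 1/12) :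
    ENNReal.ofReal ((2 / Real.pi * (1/12)) ^ (2*ν+1)) * ENNReal.ofReal (1/12)
      ≤ muN ν n (Set.Icc a (a + 1/12)) := by
  have hsub : Set.Icc a (a + 1/12) ⊆ Set.Ioo (0:ℝ) (n * Real.pi) := by
    intro x hx; constructor <;> linarith [hx.1, hx.2]
  rw [muN, withDensity_apply _ measurableSet_Icc, Measure.restrict_restrict measurableSet_Icc,
    Set.inter_eq_left.2 hsub]
  calc ENNReal.ofReal ((2 / Real.pi * (1/12)) ^ (2*ν+1)) * ENNReal.ofReal (1/12)
      = ∫⁻ x in Set.Icc a (a + 1/12), ENNReal.ofReal ((2 / Real.pi * (1/12)) ^ (2*ν+1)) := by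
        rw [setLIntegral_const, Real.volume_Icc]; congr 2; ring
    _ ≤ _ := by
      apply setLIntegral_mono' measurableSet_Icc
      intro x hx
      apply ENNReal.ofReal_le_ofReal
      apply Real.rpow_le_rpow (by positivity) _ (by linarith)
      exact sin_lower hn (by norm_num) (by linarith [hx.1]) (by linarith [hx.2])

lemma nikolskii {ν : ℝ} (hν : -(1/2 : ℝ) ≤ ν) {p : ℝ≥0∞} (hp : 0 < p) :
    ∃ C : ℝ≥0∞, C ≠ ⊤ ∧ C ≠ 0 ∧ ∀ n : ℕ, 0 < n → ∀ R : Polynomial ℂ, R.natDegree ≤ n →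
      ∀ t ∈ Set.Icc (-1:ℝ) 1, ‖R.eval (t:ℂ)‖ₑ ≤ C * ynorm ν p n R := by
  set κ := ENNReal.ofReal ((2 / Real.pi * (1/12)) ^ (2*ν+1)) * ENNReal.ofReal (1/12) with hκ
  have hpi := Real.pi_pos
  have hκ0 : κ ≠ 0 := by
    have : (0:ℝ) < (2 / Real.pi * (1/12)) ^ (2*ν+1) := by positivity
    simp only [hκ, ne_eq, mul_eq_zero, not_or, ENNReal.ofReal_eq_zero, not_le]
    exact ⟨this, by norm_num⟩
  have hκt : κ ≠ ⊤ := ENNReal.mul_ne_top ENNReal.ofReal_ne_top ENNReal.ofReal_ne_top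
  have hκp0 : κ ^ (1 / p.toReal) ≠ 0 := by
    simp [ENNReal.rpow_eq_zero_iff, hκ0, hκt]
  have hκpt : κ ^ (1 / p.toReal) ≠ ⊤ := by
    simp [ENNReal.rpow_eq_top_iff, hκ0, hκt]
  refine ⟨2 * (κ ^ (1 / p.toReal))⁻¹, ENNReal.mul_ne_top (by simp) (by simpa using hκp0),
    mul_ne_zero (by simp) (by simpa using hκpt), ?_⟩
  intro n hn R hR t ht
  have hn' : (1:ℝ) ≤ n := by exact_mod_cast hn
  obtain ⟨t0, ht0, hmax⟩ := isCompact_Icc.exists_isMaxOn (⟨t, ht⟩ : (Set.Icc (-1:ℝ) 1).Nonempty)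
    (f := fun t : ℝ => ‖R.eval (t:ℂ)‖) (by fun_prop)
  set M := ‖R.eval (t0:ℂ)‖ with hM
  have hle : ∀ s ∈ Set.Icc (-1:ℝ) 1, ‖R.eval (s:ℂ)‖ ≤ M := fun s hs => hmax hs
  have hlip := bern_lip (f := fun z => R.eval (Complex.cos (z/n))) (by fun_prop) (M := M)
    (fun z => poly_cos_bound hn hR hle z)
  set x0 := (n:ℝ) * Real.arccos t0 with hx0
  have hx0c : Real.cos (x0 / n) = t0 := by
    rw [hx0, mul_div_cancel_left₀ _ (by positivity), Real.cos_arccos ht0.1 ht0.2]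
  have hx00 : 0 ≤ x0 := by have := Real.arccos_nonneg t0; positivity
  have hx01 : x0 ≤ n * Real.pi := by
    rw [hx0]; exact mul_le_mul_of_nonneg_left (Real.arccos_le_pi t0) (by positivity)
  have hnpi : 3 < n * Real.pi := by nlinarith [Real.pi_gt_three]
  have hbig : ∀ x : ℝ, |x - x0| ≤ 1/6 → M / 2 ≤ ‖R.eval ((Real.cos (x / n) : ℝ) : ℂ)‖ := by
    intro x hx
    have h := hlip x x0
    have e1 : R.eval (Complex.cos ((x0:ℂ)/n)) = R.eval (t0:ℂ) := by
      rw [← hx0c]; push_cast; rfl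
    simp only [e1] at h
    have e2 : Complex.cos ((x:ℂ)/n) = ((Real.cos (x / n) : ℝ) : ℂ) := by push_cast; rfl
    rw [e2] at h
    have h3 := norm_sub_norm_le (R.eval (t0:ℂ)) (R.eval ((Real.cos (x / n) : ℝ) : ℂ))
    rw [norm_sub_rev] at h3
    have hM0 : 0 ≤ M := norm_nonneg _
    nlinarith
  obtain ⟨a, ha1, ha2, ha3⟩ : ∃ a : ℝ, 1/12 ≤ a ∧ a + 1/12 ≤ n * Real.pi - 1/12 ∧
      ∀ x ∈ Set.Icc a (a+1/12), |x - x0| ≤ 1/6 := by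
    rcases le_total x0 (n * Real.pi / 2) with h | h
    · refine ⟨x0 + 1/12, by linarith, by linarith, fun x hx => ?_⟩
      rw [abs_le]; constructor <;> linarith [hx.1, hx.2]
    · refine ⟨x0 - 1/6, by linarith, by linarith, fun x hx => ?_⟩
      rw [abs_le]; constructor <;> linarith [hx.1, hx.2]
  have hJ := nikolskii_aux hν hn ha1 ha2
  set J := Set.Icc a (a+1/12)
  have hJ0 : muN ν n J ≠ 0 := fun h => hκ0 (nonpos_iff_eq_zero.1 (h ▸ hJ))
  have hstep : ENNReal.ofReal (M/2) * κ ^ (1 / p.toReal) ≤ ynorm ν p n R := by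
    calc ENNReal.ofReal (M/2) * κ ^ (1 / p.toReal)
        ≤ ‖M/2‖ₑ * (muN ν n J) ^ (1 / p.toReal) := by
          rw [Real.enorm_of_nonneg (by positivity)]
          gcongr
      _ = eLpNorm (J.indicator fun _ => M/2) p (muN ν n) :=
          (eLpNorm_indicator_const' measurableSet_Icc hJ0 hp.ne').symm
      _ ≤ _ := by
        apply eLpNorm_mono
        intro x
        by_cases hx : x ∈ J
        · rw [Set.indicator_of_mem hx, Real.norm_of_nonneg (by positivity)]
          exact hbig x (ha3 x hx)
        · rw [Set.indicator_of_notMem hx]; simp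
  have h5 : ‖R.eval (t:ℂ)‖ₑ ≤ ENNReal.ofReal M := by
    rw [← ofReal_norm]; exact ENNReal.ofReal_le_ofReal (hle t ht)
  have h6 : ENNReal.ofReal M = 2 * ENNReal.ofReal (M/2) := by
    rw [show (2:ℝ≥0∞) = ENNReal.ofReal 2 by simp, ← ENNReal.ofReal_mul (by norm_num)]
    congr 1; ring
  have h7 : ENNReal.ofReal (M/2) ≤ (κ ^ (1 / p.toReal))⁻¹ * ynorm ν p n R := by
    rw [mul_comm, ← div_eq_mul_inv]
    exact (ENNReal.le_div_iff_mul_le (Or.inl hκp0) (Or.inl hκpt)).2 hstep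
  calc _ ≤ _ := h5
    _ = _ := h6
    _ ≤ 2 * ((κ ^ (1 / p.toReal))⁻¹ * ynorm ν p n R) := by gcongr
    _ = _ := by rw [mul_assoc]

lemma ae_muN {ν : ℝ} {n : ℕ} (hn : 0 < n) {P : ℝ → Prop} (h : ∀ᵐ x ∂(muN ν n), P x) :
    ∀ᵐ x : ℝ, x ∈ Set.Ioo (0:ℝ) (n * Real.pi) → P x := by
  rw [muN, ae_withDensity_iff (by fun_prop), ae_restrict_iff' measurableSet_Ioo] at h
  filter_upwards [h] with x hx hx1
  apply hx hx1
  have hn' : (0:ℝ) < n := by exact_mod_cast hn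
  have := sin_div_pos hn hx1
  have h2 : 0 < (n * Real.sin (x / n)) ^ (2 * ν + 1) := by positivity
  simpa using h2

lemma ae_muI {ν : ℝ} {P : ℝ → Prop} (h : ∀ᵐ x : ℝ, x ∈ Set.Ioi (0:ℝ) → P x) :
    ∀ᵐ x ∂(muI ν), P x := by
  rw [muI]
  apply (withDensity_absolutelyContinuous _ _).ae_le
  exact (ae_restrict_iff' measurableSet_Ioi).2 h

lemma lintegral_muN (ν : ℝ) (n : ℕ) {g : ℝ → ℝ≥0∞} (hg : Measurable g) :
    ∫⁻ x, g x ∂(muN ν n) = ∫⁻ x, (Set.Ioo (0:ℝ) (n * Real.pi)).indicator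
      (fun x => ENNReal.ofReal ((n * Real.sin (x / n)) ^ (2 * ν + 1)) * g x) x := by
  rw [muN, lintegral_withDensity_eq_lintegral_mul _ (by fun_prop) hg,
    lintegral_indicator measurableSet_Ioo]
  rfl

lemma lintegral_muI (ν : ℝ) {g : ℝ → ℝ≥0∞} (hg : Measurable g) :
    ∫⁻ x, g x ∂(muI ν) = ∫⁻ x, (Set.Ioi (0:ℝ)).indicator
      (fun x => ENNReal.ofReal (x ^ (2 * ν + 1)) * g x) x := by
  rw [muI, lintegral_withDensity_eq_lintegral_mul _ (by fun_prop) hg,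
    lintegral_indicator measurableSet_Ioi]
  rfl

lemma indicator_tendsto {ν : ℝ} (hν : -(1/2 : ℝ) ≤ ν) {n : ℕ → ℕ} (hn : Tendsto n atTop atTop)
    {g : ℕ → ℝ → ℝ≥0∞} {G : ℝ → ℝ≥0∞} (hG : ∀ x, 0 < x → G x ≠ ⊤)
    (h : ∀ x, 0 < x → Tendsto (fun k => g k x) atTop (𝓝 (G x))) (x : ℝ) :
    Tendsto (fun k => (Set.Ioo (0:ℝ) (n k * Real.pi)).indicator
      (fun x => ENNReal.ofReal ((n k * Real.sin (x / n k)) ^ (2 * ν + 1)) * g k x) x) atTop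
      (𝓝 ((Set.Ioi (0:ℝ)).indicator (fun x => ENNReal.ofReal (x ^ (2 * ν + 1)) * G x) x)) := by
  by_cases hx : 0 < x
  · rw [Set.indicator_of_mem (Set.mem_Ioi.2 hx)]
    have hn' : Tendsto (fun k => (n k : ℝ)) atTop atTop := tendsto_natCast_atTop_atTop.comp hn
    have h1 : Tendsto (fun k => ENNReal.ofReal ((n k * Real.sin (x / n k)) ^ (2 * ν + 1)) * g k x)
        atTop (𝓝 (ENNReal.ofReal (x ^ (2 * ν + 1)) * G x)) := by
      apply ENNReal.Tendsto.mul _ (Or.inr (hG x hx)) (h x hx) (Or.inr ENNReal.ofReal_ne_top)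
      apply (ENNReal.continuous_ofReal.tendsto _).comp
      exact (sin_scale hn' x).rpow_const (Or.inl hx.ne')
    apply h1.congr'
    have h2 : ∀ᶠ k in atTop, x < n k := hn'.eventually_gt_atTop x
    filter_upwards [h2] with k hk
    rw [Set.indicator_of_mem]
    refine ⟨hx, ?_⟩
    nlinarith [Real.pi_gt_three]
  · have : ∀ k, (Set.Ioo (0:ℝ) (n k * Real.pi)).indicator
      (fun x => ENNReal.ofReal ((n k * Real.sin (x / n k)) ^ (2 * ν + 1)) * g k x) x = 0 :=
      fun k => Set.indicator_of_notMem (fun h => hx h.1) _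
    simp_rw [this]
    rw [Set.indicator_of_notMem (by simpa using hx)]
    exact tendsto_const_nhds

lemma fatou {ν : ℝ} (hν : -(1/2 : ℝ) ≤ ν) {p : ℝ≥0∞} (hp : 0 < p) {n : ℕ → ℕ}
    (hn : Tendsto n atTop atTop) (hpos : ∀ k, 0 < n k)
    {f : ℕ → ℝ → ℂ} {F : ℝ → ℂ} (hf : ∀ k, Continuous (f k)) (hF : Continuous F)
    (h : ∀ x, Tendsto (fun k => f k x) atTop (𝓝 (F x))) {B : ℕ → ℝ≥0∞} {b : ℝ≥0∞}
    (hB : Tendsto B atTop (𝓝 b)) (hle : ∀ k, eLpNorm (f k) p (muN ν (n k)) ≤ B k) :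
    eLpNorm F p (muI ν) ≤ b := by
  by_cases hpt : p = ⊤
  · subst hpt
    simp only [eLpNorm_exponent_top] at hle ⊢
    have h1 : ∀ k, ∀ᵐ x : ℝ, x ∈ Set.Ioo (0:ℝ) (n k * Real.pi) → ‖f k x‖ₑ ≤ B k := fun k =>
      ae_muN (hpos k) (by filter_upwards [ae_le_eLpNormEssSup (f := f k) (μ := muN ν (n k))]
                            with x hx using hx.trans (hle k))
    refine essSup_le_of_ae_le _ ?_
    apply ae_muI
    filter_upwards [ae_all_iff.2 h1] with x hx hx0
    apply le_of_tendsto_of_tendsto ((continuous_enorm.tendsto _).comp (h x)) hB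
    have hn' : Tendsto (fun k => (n k : ℝ)) atTop atTop := tendsto_natCast_atTop_atTop.comp hn
    filter_upwards [hn'.eventually_gt_atTop x] with k hk
    apply hx k ⟨hx0, ?_⟩
    have : (0:ℝ) < x := hx0
    nlinarith [Real.pi_gt_three]
  · have hp' : 0 < p.toReal := ENNReal.toReal_pos hp.ne' hpt
    rw [eLpNorm_eq_lintegral_rpow_enorm_toReal hp.ne' hpt, one_div,
      ENNReal.rpow_inv_le_iff hp', lintegral_muI _ (by fun_prop)]
    have hle' : ∀ k, ∫⁻ x, (Set.Ioo (0:ℝ) (n k * Real.pi)).indicator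
      (fun x => ENNReal.ofReal ((n k * Real.sin (x / n k)) ^ (2 * ν + 1)) * ‖f k x‖ₑ ^ p.toReal) x
        ≤ B k ^ p.toReal := by
      intro k
      have := hle k
      rw [eLpNorm_eq_lintegral_rpow_enorm_toReal hp.ne' hpt, one_div,
        ENNReal.rpow_inv_le_iff hp', lintegral_muN _ _ (by have := hf k; fun_prop)] at this
      exact this
    have hlim := indicator_tendsto hν hn (g := fun k x => ‖f k x‖ₑ ^ p.toReal)
      (G := fun x => ‖F x‖ₑ ^ p.toReal) (by intro x _; simp [hp'.le])
      (by intro x _; exact (ENNReal.continuous_rpow_const.tendsto _).comp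
            ((continuous_enorm.tendsto _).comp (h x)))
    calc _ = ∫⁻ x, liminf (fun k => (Set.Ioo (0:ℝ) (n k * Real.pi)).indicator
            (fun x => ENNReal.ofReal ((n k * Real.sin (x / n k)) ^ (2 * ν + 1)) *
              ‖f k x‖ₑ ^ p.toReal) x) atTop := by
            apply lintegral_congr; intro x; exact (hlim x).liminf_eq.symm
      _ ≤ _ := lintegral_liminf_le (fun k => by
            have := hf k
            apply Measurable.indicator _ measurableSet_Ioo
            fun_prop)
      _ ≤ liminf (fun k => B k ^ p.toReal) atTop := liminf_le_liminf (Eventually.of_forall hle')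
      _ = b ^ p.toReal := ((ENNReal.continuous_rpow_const.tendsto _).comp hB).liminf_eq

/-- admissible functions -/
def Adm (ν : ℝ) (p : ℝ≥0∞) (f : ℂ → ℂ) : Prop :=
  SphericalType1 1 f ∧ (∀ z : ℂ, f (-z) = f z) ∧ f ≠ 0 ∧
      eLpNorm (fun t : ℝ => f t) p (wMeasR ν) ≠ ⊤

lemma ratio_eq (ν : ℝ) (p : ℝ≥0∞) {f : ℂ → ℂ} (hd : Differentiable ℂ f)
    (he : ∀ z : ℂ, f (-z) = f z) (X : ℝ≥0∞) :
    ENNReal.ofReal ((2 : ℝ) ^ (1 / p.toReal)) * (X / eLpNorm (fun t : ℝ => f t) p (wMeasR ν))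
      = X / eLpNorm (fun t : ℝ => f t) p (muI ν) := by
  have hc := hd.continuous
  rw [eLpNorm_wMeasR ν p (by fun_prop) (by intro x; push_cast; exact he x), ← mul_div_assoc]
  exact ENNReal.mul_div_mul_left _ _
    (by simpa using (by positivity : (0:ℝ) < (2:ℝ) ^ (1 / p.toReal))) (by simp)

lemma seqOp_iter_smul (ν : ℝ) (κ c : ℂ) (N : ℕ) (ρ : ℕ → ℂ) :
    (seqOp ν κ)^[N] (c • ρ) = c • (seqOp ν κ)^[N] ρ := by
  induction N generalizing ρ with
  | zero => rfl
  | succ N ih => rw [Function.iterate_succ_apply, seqOp_smul, ih, Function.iterate_succ_apply]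

lemma xval_smul (ν : ℝ) (N n : ℕ) (c : ℂ) (R : Polynomial ℂ) :
    xval ν N n (C c * R) = c * xval ν N n R := by
  have : (scaled (1/(n:ℂ)^2) (C c * R)).coeff = c • (scaled (1/(n:ℂ)^2) R).coeff := by
    funext j
    simp [scaled, Polynomial.mul_comp]
  rw [xval, xval, this, seqOp_iter_smul]; rfl

lemma ynorm_smul (ν : ℝ) (p : ℝ≥0∞) (n : ℕ) (c : ℂ) (R : Polynomial ℂ) :
    ynorm ν p n (C c * R) = ‖c‖ₑ * ynorm ν p n R := by
  rw [ynorm, ynorm, ← eLpNorm_const_smul]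
  congr 1; funext x; simp

lemma poly_normalize {R : Polynomial ℂ} (hR : R ≠ 0) : ∃ c : ℂ, c ≠ 0 ∧
    (∀ t ∈ Set.Icc (-1:ℝ) 1, ‖(C c * R).eval (t:ℂ)‖ ≤ 1) ∧
    ∃ t ∈ Set.Icc (-1:ℝ) 1, ‖(C c * R).eval (t:ℂ)‖ = 1 := by
  obtain ⟨t0, ht0, hmax⟩ := isCompact_Icc.exists_isMaxOn (⟨0, by simp⟩ : (Set.Icc (-1:ℝ) 1).Nonempty)
    (f := fun t : ℝ => ‖R.eval (t:ℂ)‖) (by fun_prop)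
  have hne : R.eval (t0:ℂ) ≠ 0 := by
    intro h0
    apply hR
    apply Polynomial.eq_zero_of_infinite_isRoot
    have hinf : (((fun t : ℝ => (t:ℂ)) '' Set.Icc (-1:ℝ) 1)).Infinite :=
      (Set.Icc_infinite (by norm_num)).image Complex.ofReal_injective.injOn
    apply hinf.mono
    rintro _ ⟨t, ht, rfl⟩
    have h1 : ‖R.eval (t:ℂ)‖ ≤ ‖R.eval (t0:ℂ)‖ := hmax ht
    rw [h0, norm_zero] at h1
    exact norm_le_zero_iff.1 h1
  have hpos : 0 < ‖R.eval (t0:ℂ)‖ := norm_pos_iff.2 hne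
  refine ⟨(R.eval (t0:ℂ))⁻¹, inv_ne_zero hne, ?_, t0, ht0, ?_⟩
  · intro t ht
    have h1 : ‖R.eval (t:ℂ)‖ ≤ ‖R.eval (t0:ℂ)‖ := hmax ht
    simp only [Polynomial.eval_mul, Polynomial.eval_C, norm_mul, norm_inv]
    rw [inv_mul_le_iff₀ hpos]; simpa using h1
  · simp [hne]

/-- the sequence of normalised polynomial constants -/
def aseq (ν : ℝ) (N : ℕ) (p : ℝ≥0∞) (n : ℕ) : ℝ≥0∞ :=
  ENNReal.ofReal ((n : ℝ) ^ (-(2 * (N : ℝ)) - (2 * ν + 2) / p.toReal)) * gegenPolyConst ν N p n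

lemma lemma_U {ν : ℝ} (hν : -(1/2 : ℝ) ≤ ν) (N : ℕ) {p : ℝ≥0∞} (hp : 0 < p)
    (hL : 0 < limsup (aseq ν N p) atTop) :
    ∃ f : ℂ → ℂ, Adm ν p f ∧ limsup (aseq ν N p) atTop ≤
      ‖(besselOp ν)^[N] f 0‖ₑ / eLpNorm (fun t : ℝ => f t) p (muI ν) := by
  set L := limsup (aseq ν N p) atTop with hLdef
  obtain ⟨c, hcmono, hc, hcL⟩ := exists_seq_strictMono_tendsto' hL
  obtain ⟨Ck, hCt, hC0, hnik⟩ := nikolskii hν hp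
  have hfreq : ∀ k, ∃ᶠ n in atTop, 0 < n ∧ c k < aseq ν N p n := by
    intro k
    exact ((frequently_lt_of_lt_limsup (by isBoundedDefault) (hc k).2).and_eventually
      (eventually_gt_atTop 0)).mono fun n h => ⟨h.2, h.1⟩
  obtain ⟨n, hnmono, hn⟩ := extraction_forall_of_frequently hfreq
  have hR : ∀ k, ∃ R : Polynomial ℂ, R.natDegree ≤ n k ∧
      (∀ t ∈ Set.Icc (-1:ℝ) 1, ‖R.eval (t:ℂ)‖ ≤ 1) ∧
      c k * ynorm ν p (n k) R ≤ ‖xval ν N (n k) R‖ₑ ∧ 1 ≤ Ck * ynorm ν p (n k) R := by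
    intro k
    obtain ⟨hnk, hlt⟩ := hn k
    rw [aseq, a_eq ν N p hnk] at hlt
    simp only [lt_iSup_iff] at hlt
    obtain ⟨R, ⟨hdeg, hR0⟩, hlt⟩ := hlt
    obtain ⟨b, hb, hb1, t, ht, hbt⟩ := poly_normalize hR0
    have hdeg' : (C b * R).natDegree ≤ n k := (Polynomial.natDegree_C_mul_le _ _).trans hdeg
    refine ⟨C b * R, hdeg', hb1, ?_, ?_⟩
    · rw [ynorm_smul, xval_smul, enorm_mul, mul_left_comm]
      gcongr
      exact ENNReal.mul_le_of_le_div hlt.le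
    · have := hnik (n k) hnk _ hdeg' t ht
      rwa [← ofReal_norm, hbt, ENNReal.ofReal_one] at this
  choose R hdeg hR1 hRx hRy using hR
  obtain ⟨φ, F, hφ, hF, hFb, hFx, hFv⟩ := compactness (M := 1) hnmono.tendsto_atTop
    (fun k => (hn k).1) hdeg hR1
  have hx := (continuous_enorm.tendsto _).comp (hFv ν N)
  set f : ℂ → ℂ := fun z => F (z^2/2) with hf
  set x := ‖(besselOp ν)^[N] f 0‖ₑ with hxdef
  have hfd : Differentiable ℂ f := by
    intro z; exact (hF _).comp z (by fun_prop)
  have hfc := hfd.continuous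
  have hx' : Tendsto (fun k => ‖xval ν N (n (φ k)) (R (φ k))‖ₑ) atTop (𝓝 x) := hx
  have hcφ : Tendsto (fun k => c (φ k)) atTop (𝓝 L) := hcL.comp hφ.tendsto_atTop
  have hx0 : x ≠ 0 := by
    intro h0
    have h1 : c 0 ≤ Ck * x := by
      refine ge_of_tendsto (ENNReal.Tendsto.const_mul hx' (Or.inr hCt)) (Eventually.of_forall ?_)
      intro k
      calc c 0 ≤ c (φ k) * 1 := by rw [mul_one]; exact hcmono.monotone (Nat.zero_le _)
        _ ≤ c (φ k) * (Ck * ynorm ν p (n (φ k)) (R (φ k))) := by gcongr; exact hRy _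
        _ = Ck * (c (φ k) * ynorm ν p (n (φ k)) (R (φ k))) := by ring
        _ ≤ _ := by gcongr; exact hRx _
    rw [h0, mul_zero] at h1
    exact absurd (hc 0).1 (not_lt.2 h1)
  have hxt : x ≠ ⊤ := enorm_ne_top
  have hI : eLpNorm (fun t : ℝ => f t) p (muI ν) ≤ x / L := by
    refine fatou hν hp (hnmono.comp hφ).tendsto_atTop (fun k => (hn (φ k)).1)
      (f := fun k x => (R (φ k)).eval ((Real.cos (x / n (φ k)):ℝ):ℂ)) (by intro k; fun_prop)
      (by have := hF.continuous; fun_prop) hFx (ENNReal.Tendsto.div hx' (Or.inl hx0) hcφ (Or.inr hxt)) ?_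
    intro k
    rw [ENNReal.le_div_iff_mul_le (Or.inl (hc _).1.ne') (Or.inr enorm_ne_top), mul_comm]
    exact hRx _
  have hIt : eLpNorm (fun t : ℝ => f t) p (muI ν) ≠ ⊤ :=
    (lt_of_le_of_lt hI (ENNReal.div_lt_top hxt hL.ne')).ne
  refine ⟨f, ⟨⟨hfd, ?_⟩, ?_, ?_, ?_⟩, ?_⟩
  · intro ε hε
    refine ⟨1, fun z => (hFb z).trans ?_⟩
    gcongr
    nlinarith [norm_nonneg z]
  · intro z; simp [hf]
  · intro h0
    apply hx0
    rw [hxdef, h0]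
    have h1 := besselOp_iter ν N (F := 0) (by fun_prop)
    have h2 : (fun z : ℂ => (0 : ℂ → ℂ) (z^2/2)) = 0 := rfl
    rw [h2] at h1
    rw [h1]
    obtain ⟨d, hd⟩ := seqOp_iter_zero ν N
    rw [hd]
    simp [tay]
  · rw [eLpNorm_wMeasR ν p (by fun_prop) (by intro x; simp [hf])]
    exact ENNReal.mul_ne_top ENNReal.ofReal_ne_top hIt
  · rw [ENNReal.le_div_iff_mul_le (Or.inr hx0) (Or.inl hIt), mul_comm]
    exact ENNReal.mul_le_of_le_div hI

/-- the entire function `sin z / z` -/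
def csinc : ℂ → ℂ := dslope Complex.sin 0

lemma csinc_zero : csinc 0 = 1 := by simp [csinc, dslope_same]

lemma csinc_ne {z : ℂ} (hz : z ≠ 0) : csinc z = Complex.sin z / z := by
  rw [csinc, dslope_of_ne _ hz, slope_def_field]; simp

lemma csinc_diff : Differentiable ℂ csinc := by
  rw [← differentiableOn_univ]
  exact (Complex.differentiableOn_dslope Filter.univ_mem).2 Complex.differentiable_sin.differentiableOn

lemma csinc_neg (z : ℂ) : csinc (-z) = csinc z := by
  by_cases hz : z = 0
  · simp [hz]
  · rw [csinc_ne hz, csinc_ne (neg_ne_zero.2 hz), Complex.sin_neg, neg_div_neg_eq]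

lemma norm_sin_le (z : ℂ) : ‖Complex.sin z‖ ≤ Real.exp |z.im| := by
  rw [Complex.sin, norm_div, norm_mul, Complex.norm_I, mul_one]
  have h1 : ‖Complex.exp (-z * Complex.I)‖ ≤ Real.exp |z.im| := by
    rw [Complex.norm_exp]; gcongr; simp [le_abs_self]
  have h2 : ‖Complex.exp (z * Complex.I)‖ ≤ Real.exp |z.im| := by
    rw [Complex.norm_exp]; gcongr; simp [neg_le_abs]
  have h3 := norm_sub_le (Complex.exp (-z * Complex.I)) (Complex.exp (z * Complex.I))
  rw [Complex.norm_ofNat, div_le_iff₀ (by norm_num)]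
  linarith

lemma csinc_bound : ∃ K : ℝ, 1 ≤ K ∧ ∀ z, ‖csinc z‖ ≤ K * Real.exp |z.im| := by
  obtain ⟨K, hK⟩ := (isCompact_closedBall (0:ℂ) 1).exists_bound_of_continuousOn
    csinc_diff.continuous.continuousOn
  refine ⟨max K 1, le_max_right _ _, fun z => ?_⟩
  by_cases hz : ‖z‖ ≤ 1
  · have h1 := hK z (by simpa using hz)
    have h2 : 1 ≤ Real.exp |z.im| := Real.one_le_exp (abs_nonneg _)
    calc ‖csinc z‖ ≤ max K 1 * 1 := by rw [mul_one]; exact h1.trans (le_max_left _ _)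
      _ ≤ _ := by gcongr
  · push Not at hz
    have hz0 : z ≠ 0 := by rintro rfl; simp at hz; linarith
    rw [csinc_ne hz0, norm_div]
    calc ‖Complex.sin z‖ / ‖z‖ ≤ ‖Complex.sin z‖ := div_le_self (norm_nonneg _) hz.le
      _ ≤ 1 * Real.exp |z.im| := by rw [one_mul]; exact norm_sin_le z
      _ ≤ _ := by gcongr; exact le_max_right _ _

lemma csinc_real_le_one (x : ℝ) : ‖csinc x‖ ≤ 1 := by
  by_cases hx : x = 0
  · simp [hx, csinc_zero]
  · rw [csinc_ne (by exact_mod_cast hx), norm_div, ← Complex.ofReal_sin, Complex.norm_real,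
      Complex.norm_real]
    exact div_le_one_of_le₀ (Real.abs_sin_le_abs) (norm_nonneg _)

lemma csinc_real_le (x : ℝ) : ‖csinc x‖ ≤ 2 / (1 + |x|) := by
  have h0 := abs_nonneg x
  by_cases hx : |x| ≤ 1
  · refine (csinc_real_le_one x).trans ?_
    rw [le_div_iff₀ (by positivity)]; linarith
  · push Not at hx
    have hx0 : x ≠ 0 := by rintro rfl; simp at hx; linarith
    rw [csinc_ne (by exact_mod_cast hx0), norm_div, ← Complex.ofReal_sin, Complex.norm_real,
      Complex.norm_real, Real.norm_eq_abs, Real.norm_eq_abs]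
    calc |Real.sin x| / |x| ≤ 1 / |x| := by gcongr; exact Real.abs_sin_le_one x
      _ ≤ _ := by rw [div_le_div_iff₀ (by positivity) (by positivity)]; linarith

/-- `D` is large enough for decay `(1+|x|)^{-D}` to be in the weighted space. -/
lemma exists_D (ν : ℝ) {p : ℝ≥0∞} (hp : 0 < p) : ∃ D : ℕ, p ≠ ⊤ → 2 * ν + 2 < D * p.toReal := by
  by_cases hpt : p = ⊤
  · exact ⟨0, fun h => absurd hpt h⟩
  · have hp' : 0 < p.toReal := ENNReal.toReal_pos hp.ne' hpt
    obtain ⟨D, hD⟩ := exists_nat_gt ((2*ν+2)/p.toReal)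
    exact ⟨D, fun _ => by rwa [div_lt_iff₀ hp'] at hD⟩

lemma dom_int {ν : ℝ} (hν : -(1/2 : ℝ) ≤ ν) {q : ℝ} (hq : 0 < q) {D : ℕ} (hD : 2 * ν + 2 < D * q)
    {A : ℝ} (hA : 0 ≤ A) :
    ∫⁻ x : ℝ, ENNReal.ofReal (|x| ^ (2 * ν + 1)) *
      ENNReal.ofReal (A * (1 + |x|)⁻¹ ^ D) ^ q ≠ ⊤ := by
  have h1 : ∀ x : ℝ, ENNReal.ofReal (|x| ^ (2 * ν + 1)) * ENNReal.ofReal (A * (1 + |x|)⁻¹ ^ D) ^ q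
      ≤ ENNReal.ofReal (A ^ q) * ENNReal.ofReal ((1 + ‖x‖) ^ (-(D * q - (2 * ν + 1)))) := by
    intro x
    have hx := abs_nonneg x
    rw [ENNReal.ofReal_rpow_of_nonneg (by positivity) hq.le, ← ENNReal.ofReal_mul (by positivity),
      ← ENNReal.ofReal_mul (by positivity)]
    apply ENNReal.ofReal_le_ofReal
    have e1 : ((1 + |x|)⁻¹ ^ D) = (1 + |x|) ^ (-(D:ℝ)) := by
      rw [Real.rpow_neg (by positivity), Real.rpow_natCast, inv_pow]
    rw [Real.mul_rpow hA (by positivity), e1, ← Real.rpow_mul (by positivity), Real.norm_eq_abs,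
      show -(D * q - (2 * ν + 1)) = (2 * ν + 1) + -(D:ℝ) * q by ring,
      Real.rpow_add (by positivity) (2 * ν + 1)]
    have h2 : |x| ^ (2 * ν + 1) ≤ (1 + |x|) ^ (2 * ν + 1) :=
      Real.rpow_le_rpow hx (by linarith) (by linarith)
    calc _ ≤ (1 + |x|) ^ (2 * ν + 1) * (A ^ q * (1 + |x|) ^ (-(D:ℝ) * q)) :=
          mul_le_mul_of_nonneg_right h2 (by positivity)
      _ = _ := by ring
  refine (lt_of_le_of_lt (lintegral_mono h1) ?_).ne
  rw [lintegral_const_mul _ (by fun_prop)]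
  apply ENNReal.mul_lt_top ENNReal.ofReal_lt_top
  exact finite_integral_one_add_norm (by simp; linarith)

lemma decay_finite {ν : ℝ} (hν : -(1/2 : ℝ) ≤ ν) {p : ℝ≥0∞} (hp : 0 < p) {D : ℕ}
    (hD : p ≠ ⊤ → 2 * ν + 2 < D * p.toReal) {f : ℝ → ℂ} (hf : Continuous f) {A : ℝ} (hA : 0 ≤ A)
    (hb : ∀ x, ‖f x‖ ≤ A * (1 + |x|)⁻¹ ^ D) : eLpNorm f p (wMeasR ν) ≠ ⊤ := by
  by_cases hpt : p = ⊤
  · subst hpt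
    rw [eLpNorm_exponent_top]
    refine (lt_of_le_of_lt (eLpNormEssSup_le_of_ae_bound (C := A) (Eventually.of_forall fun x => ?_))
      ENNReal.ofReal_lt_top).ne
    refine (hb x).trans (mul_le_of_le_one_right hA (pow_le_one₀ (by positivity) ?_))
    exact inv_le_one_of_one_le₀ (by linarith [abs_nonneg x])
  · have hp' : 0 < p.toReal := ENNReal.toReal_pos hp.ne' hpt
    rw [eLpNorm_eq_lintegral_rpow_enorm_toReal hp.ne' hpt]
    apply ENNReal.rpow_ne_top_of_nonneg (by positivity)
    rw [wMeasR, lintegral_withDensity_eq_lintegral_mul _ (by fun_prop) (by fun_prop)]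
    refine (lt_of_le_of_lt (lintegral_mono fun x => ?_) (dom_int hν hp' (hD hpt) hA).lt_top).ne
    simp only [Pi.mul_apply]
    gcongr
    rw [← ofReal_norm]
    exact ENNReal.ofReal_le_ofReal (hb x)

/-- The damping factor. -/
lemma csinc_decay {δ : ℝ} (hδ : 0 < δ) (m : ℕ) : ∃ A : ℝ, 0 < A ∧ ∀ x : ℝ,
    ‖csinc (δ * x) ^ m‖ ≤ A * (1 + |x|)⁻¹ ^ m := by
  refine ⟨(2 * max 1 δ⁻¹) ^ m, by positivity, fun x => ?_⟩
  rw [norm_pow, ← mul_pow]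
  gcongr
  have h := csinc_real_le (δ * x)
  push_cast at h
  refine h.trans ?_
  rw [← div_eq_mul_inv, div_le_div_iff₀ (by positivity) (by positivity), abs_mul, abs_of_pos hδ]
  have h1 : 1 + |x| ≤ max 1 δ⁻¹ * (1 + δ * |x|) := by
    have h3 : δ⁻¹ * δ = 1 := inv_mul_cancel₀ hδ.ne'
    have h4 := abs_nonneg x
    calc 1 + |x| = 1 * 1 + δ⁻¹ * (δ * |x|) := by rw [← mul_assoc, h3]; ring
      _ ≤ max 1 δ⁻¹ * 1 + max 1 δ⁻¹ * (δ * |x|) := by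
        gcongr; exacts [le_max_left _ _, le_max_right _ _]
      _ = _ := by ring
  nlinarith

lemma csinc_pow_bound {δ : ℝ} (hδ : 0 < δ) (m : ℕ) : ∃ A : ℝ, 0 < A ∧ ∀ z : ℂ,
    ‖csinc (δ * z) ^ m‖ ≤ A * Real.exp (m * δ * ‖z‖) := by
  obtain ⟨K, hK1, hK⟩ := csinc_bound
  refine ⟨K ^ m, by positivity, fun z => ?_⟩
  rw [norm_pow, mul_assoc, Real.exp_nat_mul, ← mul_pow]
  gcongr
  refine (hK _).trans ?_
  gcongr
  refine (Complex.abs_im_le_norm _).trans ?_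
  simp [abs_of_pos hδ]

lemma exists_adm {ν : ℝ} (hν : -(1/2 : ℝ) ≤ ν) {p : ℝ≥0∞} (hp : 0 < p) : ∃ f, Adm ν p f := by
  obtain ⟨D, hD⟩ := exists_D ν hp
  have hδ : (0:ℝ) < 1 / (D + 1) := by positivity
  obtain ⟨A, hA, hdec⟩ := csinc_decay hδ D
  obtain ⟨B, hB, hbd⟩ := csinc_pow_bound hδ D
  have hcd := csinc_diff
  have hcc := csinc_diff.continuous
  refine ⟨fun z => csinc (((1 / (D + 1) : ℝ) : ℂ) * z) ^ D, ⟨by fun_prop, fun ε hε => ⟨B, fun z => ?_⟩⟩,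
    fun z => ?_, fun h => ?_, ?_⟩
  · refine (hbd z).trans ?_
    apply mul_le_mul_of_nonneg_left _ hB.le
    apply Real.exp_le_exp.2
    apply mul_le_mul_of_nonneg_right _ (norm_nonneg z)
    have : (D:ℝ) * (1 / (D + 1)) ≤ 1 := by
      rw [mul_one_div, div_le_one (by positivity)]; linarith
    rw [one_mul]
    linarith
  · simp only [mul_neg, csinc_neg]
  · have := congrFun h 0
    simp [csinc_zero] at this
  · exact decay_finite hν hp hD (by fun_prop) hA.le hdec

lemma muP_zero : muP 0 = volume.restrict (Set.Icc (-1:ℝ) 1) := by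
  simp [muP]

lemma taylor_poly {f : ℂ → ℂ} (hd : Differentiable ℂ f) {C₀ : ℝ} (hC : 0 ≤ C₀)
    (hb : ∀ z, ‖f z‖ ≤ C₀ * Real.exp (2 * ‖z‖)) {A : ℕ} (hA : 0 < A) :
    ∃ R : Polynomial ℂ, R.natDegree ≤ 8 * A ∧ ∀ t ∈ Set.Icc (-1:ℝ) 1,
      ‖f ((A * t : ℝ) : ℂ) - R.eval (t:ℂ)‖ ≤ 2 * C₀ := by
  have hA' : (0:ℝ) < A := by exact_mod_cast hA
  refine ⟨∑ j ∈ Finset.range (8 * A), C (tay f j * A ^ j) * X ^ j, ?_, ?_⟩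
  · apply Polynomial.natDegree_sum_le_of_forall_le
    intro j hj
    exact (Polynomial.natDegree_C_mul_X_pow_le _ _).trans (Finset.mem_range.1 hj).le
  · intro t ht
    have hcoef : ∀ j, ‖tay f j‖ * (4 * A:ℝ) ^ j ≤ C₀ * Real.exp (8 * A) := by
      intro j
      apply tay_bound hd (by positivity)
      intro s hs
      refine (hb s).trans ?_
      rw [hs]; apply le_of_eq; congr 2; ring
    have hs := hasSum_tay hd ((A * t : ℝ) : ℂ)
    rw [← hasSum_nat_add_iff' (8 * A)] at hs
    have e1 : (∑ j ∈ Finset.range (8 * A), C (tay f j * A ^ j) * X ^ j : Polynomial ℂ).eval (t:ℂ)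
        = ∑ i ∈ Finset.range (8 * A), tay f i * ((A * t : ℝ) : ℂ) ^ i := by
      rw [Polynomial.eval_finsetSum]
      apply Finset.sum_congr rfl
      intro j _
      simp [mul_pow, mul_assoc]
    rw [e1, ← hs.tsum_eq]
    have hg := (hasSum_geometric_of_lt_one (r := (1/4:ℝ)) (by norm_num) (by norm_num)).mul_left C₀
    refine (tsum_of_norm_bounded hg ?_).trans ?_
    · intro j
      have ht' : |t| ≤ 1 := abs_le.2 ht
      rw [norm_mul, norm_pow, Complex.norm_real, norm_mul, Real.norm_of_nonneg hA'.le,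
        Real.norm_eq_abs]
      have h1 : ((A:ℝ) * |t|) ^ (j + 8 * A) ≤ (A:ℝ) ^ (j + 8 * A) := by
        gcongr; exact mul_le_of_le_one_right hA'.le ht'
      have h2 := hcoef (j + 8 * A)
      have h3 : Real.exp (8 * A) ≤ 4 ^ (8 * A) := by
        rw [show (8 * A : ℝ) = ((8 * A : ℕ) : ℝ) * 1 by push_cast; ring, Real.exp_nat_mul]
        gcongr
        linarith [Real.exp_one_lt_d9]
      have h4 : ‖tay f (j + 8 * A)‖ * (A:ℝ) ^ (j + 8 * A) * 4 ^ (j + 8 * A) ≤ C₀ * 4 ^ (8 * A) := by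
        calc _ = ‖tay f (j + 8 * A)‖ * (4 * A:ℝ) ^ (j + 8 * A) := by rw [mul_pow]; ring
          _ ≤ _ := h2
          _ ≤ _ := by gcongr
      rw [pow_add 4 j, ← mul_assoc] at h4
      have h5 := le_of_mul_le_mul_right h4 (by positivity)
      calc _ ≤ ‖tay f (j + 8 * A)‖ * (A:ℝ) ^ (j + 8 * A) := by gcongr
        _ ≤ C₀ / 4 ^ j := by rw [le_div_iff₀ (by positivity)]; exact h5
        _ = _ := by rw [one_div, inv_pow]; rfl
    · norm_num; linarith

lemma poly_growth {ν : ℝ} (hν : -(1/2 : ℝ) ≤ ν) {p : ℝ≥0∞} (hp : 0 < p) {f : ℂ → ℂ}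
    (hf : SphericalType1 1 f) (hW : eLpNorm (fun t : ℝ => f t) p (wMeasR ν) ≠ ⊤) :
    ∃ (B : ℝ) (K : ℕ), 0 ≤ B ∧ ∀ x : ℝ, ‖f x‖ ≤ B * (1 + |x|) ^ K := by
  obtain ⟨hd, hb⟩ := hf
  have hc := hd.continuous
  obtain ⟨C₀, hC₀⟩ := hb 1 one_pos
  have hC0 : 0 ≤ C₀ := by
    have := (norm_nonneg _).trans (hC₀ 0)
    simpa using this
  have hC₀' : ∀ z, ‖f z‖ ≤ C₀ * Real.exp (2 * ‖z‖) := by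
    intro z; have := hC₀ z; norm_num at this; exact this
  set C₁ := C₀ * Real.exp 2 with hC1
  have hC1' : 0 ≤ C₁ := by positivity
  obtain ⟨Ck, hCt, -, hnik⟩ := nikolskii (ν := 0) (by norm_num) hp
  set W := eLpNorm (fun t : ℝ => f t) p (wMeasR ν) with hWdef
  set E1 := eLpNorm (fun _ : ℝ => 2 * C₀ + C₁) p (muP 0) with hE1
  have hE1t : E1 ≠ ⊤ := by
    have : MemLp (fun _ : ℝ => 2 * C₀ + C₁) p (volume.restrict (Set.Icc (-1:ℝ) 1)) := memLp_const _
    rw [hE1, muP_zero]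
    exact this.2.ne
  obtain ⟨K, hK⟩ := exists_nat_gt (2 / p.toReal + (2 * ν + 1) / p.toReal)
  set Q := ENNReal.ofReal (2 * C₀) + Ck * (ENNReal.ofReal ((8:ℝ) ^ (2 / p.toReal)) *
    (p.LpAddConst * (E1 + W))) with hQ
  have hQt : Q ≠ ⊤ := by
    have := (ENNReal.LpAddConst_lt_top p).ne
    have h3 : p.LpAddConst * (E1 + W) ≠ ⊤ := ENNReal.mul_ne_top this (ENNReal.add_ne_top.2 ⟨hE1t, hW⟩)
    exact ENNReal.add_ne_top.2 ⟨ENNReal.ofReal_ne_top, ENNReal.mul_ne_top hCt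
      (ENNReal.mul_ne_top ENNReal.ofReal_ne_top h3)⟩
  have main : ∀ A : ℕ, 0 < A → ∀ t ∈ Set.Icc (-1:ℝ) 1,
      ‖f ((A * t : ℝ) : ℂ)‖ₑ ≤ ENNReal.ofReal ((A:ℝ) ^ K) * Q := by
    intro A hA t ht
    have hA' : (1:ℝ) ≤ A := by exact_mod_cast hA
    have hA0 : (0:ℝ) < A := by linarith
    obtain ⟨R, hRd, hR⟩ := taylor_poly hd hC0 hC₀' hA
    have hR1 : ‖f ((A * t : ℝ) : ℂ)‖ₑ ≤ ENNReal.ofReal (2 * C₀) + ‖R.eval (t:ℂ)‖ₑ := by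
      rw [← ofReal_norm, ← ofReal_norm, ← ENNReal.ofReal_add (by positivity) (norm_nonneg _)]
      apply ENNReal.ofReal_le_ofReal
      have := norm_sub_norm_le (f ((A * t : ℝ) : ℂ)) (R.eval (t:ℂ))
      linarith [hR t ht]
    have hR2 := hnik (8 * A) (by positivity) R hRd t ht
    have hR3 := eLpNorm_muP 0 (n := 8 * A) (by positivity) p (g := fun t : ℝ => R.eval (t : ℂ))
      (by fun_prop)
    have hy : ynorm 0 p (8 * A) R = ENNReal.ofReal (((8 * A : ℕ):ℝ) ^ (2 / p.toReal)) *
        eLpNorm (fun t : ℝ => R.eval (t : ℂ)) p (muP 0) := by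
      rw [hR3, ← mul_assoc, ← ENNReal.ofReal_mul (by positivity), ← Real.rpow_add (by positivity)]
      simp only [mul_zero, zero_add]
      rw [← add_div]; simp [ynorm]
    set S : Set ℝ := {t | 1 ≤ A * |t|} with hS
    have hSm : MeasurableSet S := measurableSet_le measurable_const (by fun_prop)
    have hdom : eLpNorm (fun t : ℝ => R.eval (t : ℂ)) p (muP 0) ≤
        p.LpAddConst * (E1 + ENNReal.ofReal ((A:ℝ) ^ ((2 * ν + 1) / p.toReal)) * W) := by
      have h1 : eLpNorm (fun t : ℝ => R.eval (t : ℂ)) p (muP 0) ≤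
          eLpNorm ((fun _ : ℝ => 2 * C₀ + C₁) + S.indicator (fun t => ‖f ((A * t : ℝ) : ℂ)‖))
            p (muP 0) := by
        apply eLpNorm_mono_ae_real
        rw [muP_zero]
        filter_upwards [ae_restrict_mem measurableSet_Icc] with s hs
        have h2 := norm_sub_norm_le (R.eval (s:ℂ)) (f ((A * s : ℝ) : ℂ))
        rw [norm_sub_rev] at h2
        have h3 := hR s hs
        simp only [Pi.add_apply]
        by_cases hsS : s ∈ S
        · rw [Set.indicator_of_mem hsS]; linarith
        · rw [Set.indicator_of_notMem hsS]
          have h4 : A * |s| < 1 := not_le.1 hsS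
          have h5 : ‖f ((A * s : ℝ) : ℂ)‖ ≤ C₁ := by
            refine (hC₀' _).trans ?_
            rw [hC1, Complex.norm_real, norm_mul, Real.norm_of_nonneg hA0.le, Real.norm_eq_abs]
            gcongr
            linarith
          linarith
      refine h1.trans ((eLpNorm_add_le' (by fun_prop) (AEStronglyMeasurable.indicator
        (by fun_prop) hSm) p).trans ?_)
      gcongr
      rw [eLpNorm_indicator_eq_eLpNorm_restrict hSm, eLpNorm_norm]
      have hmeas : (muP 0).restrict S ≤ ENNReal.ofReal ((A:ℝ) ^ (2 * ν + 1)) • wMeasR ν := by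
        calc (muP 0).restrict S ≤ volume.restrict S := by
              rw [muP_zero]; exact Measure.restrict_mono_measure Measure.restrict_le_self _
          _ = volume.withDensity (S.indicator 1) := by rw [withDensity_indicator hSm, withDensity_one]
          _ ≤ volume.withDensity (ENNReal.ofReal ((A:ℝ) ^ (2 * ν + 1)) •
              fun t : ℝ => ENNReal.ofReal (|t| ^ (2 * ν + 1))) := by
              apply withDensity_mono
              refine Eventually.of_forall fun s => ?_
              apply Set.indicator_le
              intro s hs
              simp only [Pi.one_apply, Pi.smul_apply, smul_eq_mul]
              rw [← ENNReal.ofReal_mul (by positivity), ← Real.mul_rpow hA0.le (abs_nonneg _)]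
              exact ENNReal.one_le_ofReal.2 (Real.one_le_rpow hs (by linarith))
          _ = _ := withDensity_smul _ (by fun_prop)
      have hAp : 0 < (A:ℝ) ^ (2 * ν + 1) := by positivity
      refine (eLpNorm_mono_measure _ hmeas).trans ?_
      rw [eLpNorm_smul_measure_of_ne_zero (by simpa using hAp), smul_eq_mul]
      have e1 : ENNReal.ofReal ((A:ℝ) ^ (2 * ν + 1)) ^ (1 / p).toReal
          = ENNReal.ofReal ((A:ℝ) ^ ((2 * ν + 1) / p.toReal)) := by
        rw [one_div, ENNReal.toReal_inv, ENNReal.ofReal_rpow_of_pos hAp, ← Real.rpow_mul hA0.le]; rfl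
      rw [e1]
      gcongr
      rw [eLpNorm_dilate ν p (f := fun t : ℝ => f t) (by fun_prop) hA0]
      apply mul_le_of_le_one_left (by simp)
      rw [ENNReal.ofReal_le_one]
      apply Real.rpow_le_one_of_one_le_of_nonpos hA'
      exact div_nonpos_of_nonpos_of_nonneg (by linarith) ENNReal.toReal_nonneg
    have hpn : 0 ≤ p.toReal := ENNReal.toReal_nonneg
    have k1 : ENNReal.ofReal ((A:ℝ) ^ (2 / p.toReal)) *
        ENNReal.ofReal ((A:ℝ) ^ ((2 * ν + 1) / p.toReal)) ≤ ENNReal.ofReal ((A:ℝ) ^ K) := by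
      rw [← ENNReal.ofReal_mul (by positivity), ← Real.rpow_add hA0, ← Real.rpow_natCast]
      exact ENNReal.ofReal_le_ofReal (Real.rpow_le_rpow_of_exponent_le hA' hK.le)
    have k2 : 1 ≤ ENNReal.ofReal ((A:ℝ) ^ ((2 * ν + 1) / p.toReal)) :=
      ENNReal.one_le_ofReal.2 (Real.one_le_rpow hA' (div_nonneg (by linarith) hpn))
    have k3 : 1 ≤ ENNReal.ofReal ((A:ℝ) ^ K) := ENNReal.one_le_ofReal.2 (one_le_pow₀ hA')
    set a1 := ENNReal.ofReal ((A:ℝ) ^ (2 / p.toReal)) with ha1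
    set a2 := ENNReal.ofReal ((A:ℝ) ^ ((2 * ν + 1) / p.toReal)) with ha2
    have e8 : ENNReal.ofReal (((8 * A : ℕ):ℝ) ^ (2 / p.toReal)) =
        ENNReal.ofReal ((8:ℝ) ^ (2 / p.toReal)) * a1 := by
      rw [ha1, ← ENNReal.ofReal_mul (by positivity)]; push_cast
      rw [Real.mul_rpow (by norm_num) hA0.le]
    calc _ ≤ ENNReal.ofReal (2 * C₀) + Ck * ynorm 0 p (8 * A) R := hR1.trans (by gcongr)
      _ ≤ ENNReal.ofReal (2 * C₀) + Ck * (ENNReal.ofReal ((8:ℝ) ^ (2 / p.toReal)) * a1 *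
            (p.LpAddConst * (a2 * E1 + a2 * W))) := by
          rw [hy, e8]; gcongr
          refine hdom.trans ?_
          gcongr
          exact le_mul_of_one_le_left (by simp) k2
      _ = 1 * ENNReal.ofReal (2 * C₀) + (a1 * a2) * (Ck * (ENNReal.ofReal ((8:ℝ) ^ (2 / p.toReal)) *
            (p.LpAddConst * (E1 + W)))) := by ring
      _ ≤ ENNReal.ofReal ((A:ℝ) ^ K) * ENNReal.ofReal (2 * C₀) + ENNReal.ofReal ((A:ℝ) ^ K) *
            (Ck * (ENNReal.ofReal ((8:ℝ) ^ (2 / p.toReal)) * (p.LpAddConst * (E1 + W)))) := by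
          gcongr
      _ = _ := by rw [hQ]; ring
  refine ⟨Q.toReal * 2 ^ K, K, by positivity, fun x => ?_⟩
  set A := ⌈|x|⌉₊ + 1 with hA
  have hAx : (A:ℝ) ≤ 2 * (1 + |x|) := by
    have := (Nat.ceil_lt_add_one (abs_nonneg x)).le
    rw [hA]; push_cast; linarith [abs_nonneg x]
  have hxA : |x| ≤ A := by
    have := Nat.le_ceil |x|
    rw [hA]; push_cast; linarith
  have hA0 : (0:ℝ) < A := by rw [hA]; positivity
  have h := main A (Nat.succ_pos _) (x / A) (by
    rw [Set.mem_Icc, ← abs_le, abs_div, abs_of_pos hA0]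
    exact div_le_one_of_le₀ hxA hA0.le)
  rw [mul_div_cancel₀ _ hA0.ne'] at h
  have h2 := ENNReal.toReal_mono (ENNReal.mul_ne_top ENNReal.ofReal_ne_top hQt) h
  rw [toReal_enorm, ENNReal.toReal_mul, ENNReal.toReal_ofReal (by positivity)] at h2
  calc ‖f x‖ ≤ _ := h2
    _ ≤ (2 * (1 + |x|)) ^ K * Q.toReal := by gcongr
    _ = _ := by rw [mul_pow]; ring

lemma sup_le_eLpNorm_top (ν : ℝ) {h : ℝ → ℂ} (hc : Continuous h) (x : ℝ) :
    ‖h x‖ₑ ≤ eLpNorm h ⊤ (wMeasR ν) := by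
  rw [eLpNorm_exponent_top]
  have h1 := ae_le_eLpNormEssSup (f := h) (μ := wMeasR ν)
  set c := eLpNormEssSup h (wMeasR ν)
  rw [wMeasR, ae_withDensity_iff (by fun_prop)] at h1
  have h2 : ∀ᵐ t : ℝ, ‖h t‖ₑ ≤ c := by
    filter_upwards [h1, Measure.ae_ne volume (0:ℝ)] with t ht ht0
    apply ht
    have : 0 < |t| ^ (2 * ν + 1) := by have := abs_pos.2 ht0; positivity
    simpa using this
  have h3 := Measure.dense_of_ae h2
  have h4 : IsClosed {t : ℝ | ‖h t‖ₑ ≤ c} := isClosed_le (by fun_prop) continuous_const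
  have h5 := h4.closure_eq ▸ h3.closure_eq
  exact (h5 ▸ Set.mem_univ x : x ∈ {t : ℝ | ‖h t‖ₑ ≤ c})

lemma contour_shift {Φ : ℂ → ℂ} (hd : Differentiable ℂ Φ)
    (hper : ∀ z, Φ (z + (2 * Real.pi : ℝ)) = Φ z) (y : ℝ) :
    ∫ x in (0:ℝ)..(2 * Real.pi), Φ x = ∫ x in (0:ℝ)..(2 * Real.pi), Φ (x + y * Complex.I) := by
  have h := Complex.integral_boundary_rect_eq_zero_of_differentiableOn Φ 0
    (((2 * Real.pi : ℝ) : ℂ) + y * Complex.I) hd.differentiableOn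
  simp only [Complex.add_re, Complex.add_im, Complex.ofReal_re, Complex.ofReal_im, Complex.mul_re,
    Complex.mul_im, Complex.I_re, Complex.I_im, Complex.zero_re, Complex.zero_im, mul_zero, mul_one,
    zero_add, add_zero, sub_zero, Complex.ofReal_zero, zero_mul] at h
  have h2 : ∀ t : ℝ, Φ (((2 * Real.pi : ℝ) : ℂ) + t * Complex.I) = Φ (t * Complex.I) := by
    intro t; rw [add_comm]; exact hper _
  simp only [h2, add_sub_cancel_right] at h
  exact sub_eq_zero.1 h

lemma fourier_rep {Q : ℂ → ℂ} (hd : Differentiable ℂ Q)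
    (hper : ∀ z, Q (z + (2 * Real.pi : ℝ)) = Q z) {B η : ℝ} (hη : 0 < η)
    (hB : ∀ x y : ℝ, |y| = η → ‖Q (x + y * Complex.I)‖ ≤ B) :
    ∃ c : ℤ → ℂ, (∀ k, ‖c k‖ ≤ B * Real.exp (-(|(k:ℝ)| * η))) ∧
      ∀ x : ℝ, HasSum (fun k : ℤ => c k * Complex.exp (Complex.I * k * x)) (Q x) := by
  have : Fact (0 < 2 * Real.pi) := ⟨by positivity⟩
  have hpi : (Real.pi : ℂ) ≠ 0 := by exact_mod_cast Real.pi_ne_zero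
  have hc := hd.continuous
  have hperR : Function.Periodic (fun x : ℝ => Q x) (2 * Real.pi) := by
    intro x; have := hper x; simp only; rw [← this]; push_cast; rfl
  have hlc : Continuous hperR.lift := by
    apply continuous_coinduced_dom.2
    change Continuous (fun x : ℝ => hperR.lift (x : AddCircle (2 * Real.pi)))
    simp only [Function.Periodic.lift_coe]
    fun_prop
  set q : C(AddCircle (2 * Real.pi), ℂ) := ⟨hperR.lift, hlc⟩ with hq
  have hqx : ∀ x : ℝ, q (x : AddCircle (2 * Real.pi)) = Q x := fun x => hperR.lift_coe x
  have hfour : ∀ (k : ℤ) (x : ℝ), fourier k (x : AddCircle (2 * Real.pi))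
      = Complex.exp (Complex.I * k * x) := by
    intro k x
    rw [fourier_coe_apply]
    congr 1
    push_cast
    field_simp
  have hbound : ∀ k, ‖fourierCoeff q k‖ ≤ B * Real.exp (-(|(k:ℝ)| * η)) := by
    intro k
    rw [fourierCoeff_eq_intervalIntegral q k 0]
    simp only [hqx, hfour, smul_eq_mul, zero_add]
    obtain ⟨y, hy1, hy2⟩ : ∃ y : ℝ, |y| = η ∧ (k:ℝ) * y = -(|(k:ℝ)| * η) := by
      rcases le_total 0 (k:ℝ) with h | h
      · exact ⟨-η, by rw [abs_neg, abs_of_pos hη], by rw [abs_of_nonneg h]; ring⟩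
      · exact ⟨η, abs_of_pos hη, by rw [abs_of_nonpos h]; ring⟩
    have hs := contour_shift (Φ := fun z => Complex.exp (Complex.I * ((-k : ℤ) : ℂ) * z) * Q z)
      (by fun_prop) (by
        intro z
        rw [hper]
        congr 1
        rw [Complex.exp_eq_exp_iff_exists_int]
        exact ⟨-k, by push_cast; ring⟩) y
    rw [hs, norm_smul]
    have h1 := intervalIntegral.norm_integral_le_of_norm_le_const (a := 0) (b := 2 * Real.pi)
      (f := fun x : ℝ => Complex.exp (Complex.I * ((-k : ℤ) : ℂ) * (x + y * Complex.I)) *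
        Q (x + y * Complex.I)) (C := Real.exp (-(|(k:ℝ)| * η)) * B) (by
        intro x _
        rw [norm_mul, Complex.norm_exp]
        have e : (Complex.I * ((-k : ℤ) : ℂ) * (x + y * Complex.I)).re = k * y := by
          simp [Complex.mul_re, Complex.mul_im]
        rw [e, hy2]
        gcongr
        exact hB x y hy1)
    rw [sub_zero, abs_of_pos (show (0:ℝ) < 2 * Real.pi by positivity)] at h1
    calc _ ≤ ‖1 / (2 * Real.pi)‖ * (Real.exp (-(|(k:ℝ)| * η)) * B * (2 * Real.pi)) := by gcongr
      _ = _ := by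
        rw [Real.norm_of_nonneg (by positivity)]; field_simp
  refine ⟨fourierCoeff q, hbound, fun x => ?_⟩
  have hsumexp : Summable (fun k : ℤ => B * Real.exp (-(|(k:ℝ)| * η))) := by
    apply Summable.mul_left
    have h0 : Summable (fun n : ℕ => Real.exp (-((n:ℝ) * η))) := by
      have := summable_geometric_of_lt_one (r := Real.exp (-η)) (by positivity)
        (Real.exp_lt_one_iff.2 (by linarith))
      refine this.congr fun n => ?_
      rw [← Real.exp_nat_mul]; congr 1; ring
    apply Summable.of_nat_of_neg <;> simpa using h0
  have := has_pointwise_sum_fourier_series_of_summable (f := q)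
    (Summable.of_norm_bounded hsumexp hbound) (x : AddCircle (2 * Real.pi))
  simpa only [hqx, hfour, smul_eq_mul] using this

lemma summable_exp_int {d : ℝ} (hd : 0 < d) : Summable (fun k : ℤ => Real.exp (-(|(k:ℝ)| * d))) := by
  have h0 : Summable (fun n : ℕ => Real.exp (-((n:ℝ) * d))) := by
    have := summable_geometric_of_lt_one (r := Real.exp (-d)) (by positivity)
      (Real.exp_lt_one_iff.2 (by linarith))
    refine this.congr fun n => ?_
    rw [← Real.exp_nat_mul]; congr 1; ring
  apply Summable.of_nat_of_neg <;> simpa using h0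

lemma sinh_le {x : ℝ} (h0 : 0 ≤ x) (h1 : x ≤ 1) : Real.sinh x ≤ x + x ^ 2 := by
  have a := abs_le.1 (Real.abs_exp_sub_one_sub_id_le (x := x) (by rw [abs_of_nonneg h0]; exact h1))
  have b := abs_le.1 (Real.abs_exp_sub_one_sub_id_le (x := -x) (by rw [abs_neg, abs_of_nonneg h0]; exact h1))
  rw [Real.sinh_eq]
  nlinarith [a.2, b.1]

lemma im_sin_le (x y : ℝ) : |(Complex.sin (((x:ℂ) + y * Complex.I) / 2)).im| ≤ Real.sinh (|y| / 2) := by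
  have e : ((x:ℂ) + y * Complex.I) / 2 = ((x/2 : ℝ) : ℂ) + ((y/2 : ℝ) : ℂ) * Complex.I := by
    push_cast; ring
  rw [e, Complex.sin_add_mul_I, ← Complex.ofReal_sin, ← Complex.ofReal_cos, ← Complex.ofReal_sinh,
    ← Complex.ofReal_cosh]
  simp only [Complex.add_im, Complex.mul_im, Complex.mul_re, Complex.ofReal_re, Complex.ofReal_im,
    Complex.I_re, Complex.I_im, mul_zero, zero_mul, mul_one, add_zero, zero_add, sub_zero]
  rw [abs_mul, Real.abs_sinh, abs_div, abs_of_pos (by norm_num : (0:ℝ) < 2)]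
  exact mul_le_of_le_one_left (Real.sinh_nonneg_iff.2 (by positivity)) (Real.abs_cos_le_one _)

lemma cheb_trunc {h : ℂ → ℂ} (hd : Differentiable ℂ h) (he : ∀ z, h (-z) = h z) {M σ : ℝ}
    (hσ : 0 < σ) (hσ1 : σ < 1) (hM : 0 ≤ M) (hb : ∀ z, ‖h z‖ ≤ M * Real.exp (σ * |z.im|)) :
    ∃ (A q : ℝ), 0 ≤ A ∧ 0 < q ∧ q < 1 ∧ ∀ n : ℕ, ∃ R : Polynomial ℂ, R.natDegree ≤ n ∧
      ∀ θ : ℝ, ‖R.eval ((Real.cos θ : ℝ) : ℂ) - h ((2 * n * Real.sin (θ / 2) : ℝ) : ℂ)‖ ≤ A * q ^ n := by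
  set d := (1 - σ) ^ 2 / 4 with hdd
  have hd0 : 0 < d := by have : 0 < 1 - σ := by linarith
                         positivity
  set η := 1 - σ with hη
  have hη0 : 0 < η := by linarith
  set S := ∑' k : ℤ, Real.exp (-(|(k:ℝ)| * d)) with hS
  have hS0 : 0 ≤ S := tsum_nonneg fun k => by positivity
  refine ⟨M * S, Real.exp (-d), by positivity, by positivity, Real.exp_lt_one_iff.2 (by linarith), fun n => ?_⟩
  set Q : ℂ → ℂ := fun z => h (2 * n * Complex.sin (z / 2)) with hQ
  have hQd : Differentiable ℂ Q := by
    intro z; exact (hd _).comp z (by fun_prop)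
  have hQper : ∀ z, Q (z + (2 * Real.pi : ℝ)) = Q z := by
    intro z
    simp only [hQ]
    rw [← he]; congr 1
    rw [show (z + ((2 * Real.pi : ℝ) : ℂ)) / 2 = z / 2 + Real.pi by push_cast; ring,
      Complex.sin_add_pi]; ring
  have hQe : ∀ x : ℝ, Q ((-x : ℝ) : ℂ) = Q x := by
    intro x
    simp only [hQ]
    rw [← he]; congr 1
    push_cast
    rw [neg_div, Complex.sin_neg]; ring
  set B := M * Real.exp (σ * (2 * n * Real.sinh (η / 2))) with hB
  obtain ⟨c, hc, hsum⟩ := fourier_rep hQd hQper (B := B) hη0 (by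
    intro x y hy
    refine (hb _).trans ?_
    rw [hB, ← hy]
    gcongr
    have e : (2 * n * Complex.sin (((x:ℂ) + y * Complex.I) / 2)).im
      = 2 * n * (Complex.sin (((x:ℂ) + y * Complex.I) / 2)).im := by
      rw [show (2 * (n:ℂ)) = ((2 * n : ℝ) : ℂ) by push_cast; ring, Complex.im_ofReal_mul]
    rw [e, abs_mul, abs_of_nonneg (by positivity)]
    gcongr
    exact im_sin_le x y)
  have hcos : ∀ x : ℝ, HasSum (fun k : ℤ => c k * Complex.cos (k * x)) (Q x) := by
    intro x
    have h1 := ((hsum x).add (hsum (-x))).div_const 2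
    rw [hQe] at h1
    rw [show (Q x + Q x) / 2 = Q x by ring] at h1
    refine (congrArg (fun g => HasSum g (Q x)) ?_).mpr h1
    funext k
    rw [Complex.cos]
    push_cast
    rw [show (k:ℂ) * x * Complex.I = Complex.I * k * x by ring,
      show -((k:ℂ) * x) * Complex.I = Complex.I * k * -x by ring]
    ring
  refine ⟨∑ k ∈ Finset.Icc (-(n:ℤ)) n, C (c k) * Polynomial.Chebyshev.T ℂ k, ?_, ?_⟩
  · apply Polynomial.natDegree_sum_le_of_forall_le
    intro k hk
    refine (Polynomial.natDegree_C_mul_le _ _).trans ?_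
    rw [Polynomial.Chebyshev.natDegree_T]
    rw [Finset.mem_Icc] at hk
    omega
  · intro θ
    have e1 : (∑ k ∈ Finset.Icc (-(n:ℤ)) n, C (c k) * Polynomial.Chebyshev.T ℂ k).eval
        ((Real.cos θ : ℝ) : ℂ) = ∑ k ∈ Finset.Icc (-(n:ℤ)) n, c k * Complex.cos (k * θ) := by
      rw [Polynomial.eval_finsetSum]
      apply Finset.sum_congr rfl
      intro k _
      rw [Polynomial.eval_mul, Polynomial.eval_C, Complex.ofReal_cos,
        Polynomial.Chebyshev.T_complex_cos]
    have e2 : h ((2 * n * Real.sin (θ / 2) : ℝ) : ℂ) = Q θ := by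
      simp only [hQ]; push_cast; rfl
    rw [e1, e2, norm_sub_rev]
    have hfin : HasSum (fun k : ℤ => if k ∈ Finset.Icc (-(n:ℤ)) n then c k * Complex.cos (k * θ) else 0)
        (∑ k ∈ Finset.Icc (-(n:ℤ)) n, c k * Complex.cos (k * θ)) := by
      have := hasSum_sum_of_ne_finset_zero (L := SummationFilter.unconditional ℤ)
        (f := fun k : ℤ => if k ∈ Finset.Icc (-(n:ℤ)) n then c k * Complex.cos (k * θ) else 0)
        (s := Finset.Icc (-(n:ℤ)) n) (by intro b hb; simp [hb])
      convert this using 1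
      apply Finset.sum_congr rfl
      intro k hk; simp [hk]
    have hdiff := (hcos θ).sub hfin
    rw [← hdiff.tsum_eq]
    have hdom := ((summable_exp_int hd0).hasSum).mul_left (M * Real.exp (-d) ^ n)
    refine (tsum_of_norm_bounded hdom ?_).trans (le_of_eq ?_)
    · intro k
      by_cases hk : k ∈ Finset.Icc (-(n:ℤ)) n
      · rw [if_pos hk]; simp; positivity
      · rw [if_neg hk, sub_zero, norm_mul]
        have hk' : (n:ℝ) ≤ |(k:ℝ)| := by
          rw [Finset.mem_Icc] at hk
          have : (n:ℤ) ≤ |k| := by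
            by_contra hcon
            push Not at hcon
            exact hk ⟨(abs_lt.1 hcon).1.le, (abs_lt.1 hcon).2.le⟩
          exact_mod_cast this
        have hc1 : ‖Complex.cos (k * θ)‖ ≤ 1 := by
          rw [show ((k:ℂ) * θ) = (((k:ℝ) * θ : ℝ) : ℂ) by push_cast; rfl, ← Complex.ofReal_cos,
            Complex.norm_real]
          exact Real.abs_cos_le_one _
        have hexp : σ * (2 * n * Real.sinh (η / 2)) - |(k:ℝ)| * η ≤ -(n * d) - |(k:ℝ)| * d := by
          have s1 := sinh_le (x := η / 2) (by positivity) (by linarith)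
          have s2 : σ * (2 * n * Real.sinh (η / 2)) ≤ σ * (2 * n * (η / 2 + (η / 2)^2)) := by gcongr
          have s3 : σ = 1 - η := by rw [hη]; ring
          have hd' : d = η ^ 2 / 4 := hdd
          have s4 : σ * (2 * n * (η / 2 + (η / 2)^2)) ≤ n * (η - η ^ 2 / 2) := by
            have hn0 : (0:ℝ) ≤ n := by positivity
            have : σ * (2 * (η / 2 + (η / 2)^2)) ≤ η - η ^ 2 / 2 := by
              rw [s3]; nlinarith [pow_pos hη0 3]
            calc _ = n * (σ * (2 * (η / 2 + (η / 2)^2))) := by ring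
              _ ≤ _ := by gcongr
          have s5 : n * (η - η^2/4) ≤ |(k:ℝ)| * (η - η^2/4) := by
            apply mul_le_mul_of_nonneg_right hk'
            nlinarith
          rw [hd']
          nlinarith
        calc ‖c k‖ * ‖Complex.cos (k * θ)‖ ≤ ‖c k‖ * 1 := by gcongr
          _ ≤ B * Real.exp (-(|(k:ℝ)| * η)) := by rw [mul_one]; exact hc k
          _ = M * Real.exp (σ * (2 * n * Real.sinh (η / 2)) - |(k:ℝ)| * η) := by
            rw [hB, mul_assoc, ← Real.exp_add]; rfl
          _ ≤ M * Real.exp (-(n * d) - |(k:ℝ)| * d) := by gcongr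
          _ = _ := by
            rw [mul_assoc, ← Real.exp_nat_mul, ← Real.exp_add]; congr 2; ring
    · rw [← hS]; ring

lemma aseq_ge (ν : ℝ) (N : ℕ) (p : ℝ≥0∞) {n : ℕ} (hn : 0 < n) {R : Polynomial ℂ}
    (hR : R.natDegree ≤ n) : ‖xval ν N n R‖ₑ / ynorm ν p n R ≤ aseq ν N p n := by
  by_cases h0 : R = 0
  · have : xval ν N n R = 0 := by
      have := xval_smul ν N n 0 R
      rw [h0] at this ⊢
      simpa using this
    rw [this]; simp
  · rw [aseq, a_eq ν N p hn]
    exact le_iSup₂_of_le R ⟨hR, h0⟩ le_rfl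

lemma eq_of_real {f g : ℂ → ℂ} (hf : Differentiable ℂ f) (hg : Differentiable ℂ g)
    (h : ∀ x : ℝ, f x = g x) : f = g := by
  have hf' : AnalyticOnNhd ℂ f Set.univ := (hf.differentiableOn).analyticOnNhd isOpen_univ
  have hg' : AnalyticOnNhd ℂ g Set.univ := (hg.differentiableOn).analyticOnNhd isOpen_univ
  refine hf'.eq_of_frequently_eq hg' (z₀ := 0) ?_
  have ht : Tendsto (fun k : ℕ => ((1 / ((k:ℝ) + 1) : ℝ) : ℂ)) atTop (𝓝[≠] 0) := by
    rw [tendsto_nhdsWithin_iff]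
    constructor
    · have := (Complex.continuous_ofReal.tendsto _).comp
        (tendsto_one_div_add_atTop_nhds_zero_nat (𝕜 := ℝ))
      rw [Complex.ofReal_zero] at this
      exact this
    · refine Eventually.of_forall fun k => ?_
      simp only [Set.mem_compl_iff, Set.mem_singleton_iff, Complex.ofReal_eq_zero]
      positivity
  exact ht.frequently (Eventually.of_forall fun k => h _).frequently

lemma geo_decay {q : ℝ} (hq0 : 0 < q) (hq1 : q < 1) (D : ℕ) :
    ∃ C : ℝ, 0 ≤ C ∧ ∀ n : ℕ, 0 < n → ∀ x : ℝ, 0 ≤ x → x ≤ n * Real.pi →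
      q ^ n ≤ C * (1 + x)⁻¹ ^ D := by
  have ht := tendsto_pow_const_mul_const_pow_of_abs_lt_one D
    (r := q) (by rw [abs_of_pos hq0]; exact hq1)
  obtain ⟨C, hC⟩ := ht.bddAbove_range
  have hC' : ∀ n : ℕ, (n:ℝ) ^ D * q ^ n ≤ C := fun n => hC ⟨n, rfl⟩
  have hC0 : 0 ≤ C := le_trans (by positivity) (hC' 0)
  refine ⟨C * 5 ^ D, by positivity, fun n hn x h0 h1 => ?_⟩
  have hn1 : (1:ℝ) ≤ n := by exact_mod_cast hn
  have hx : 1 + x ≤ 5 * n := by nlinarith [Real.pi_le_four]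
  rw [inv_pow, ← div_eq_mul_inv, le_div_iff₀ (by positivity)]
  calc q ^ n * (1 + x) ^ D ≤ q ^ n * (5 * n) ^ D := by gcongr
    _ = ((n:ℝ) ^ D * q ^ n) * 5 ^ D := by rw [mul_pow]; ring
    _ ≤ _ := by gcongr; exact hC' n

lemma core_L {ν : ℝ} (hν : -(1/2 : ℝ) ≤ ν) (N : ℕ) {p : ℝ≥0∞} (hp : 0 < p) {D : ℕ}
    (hD : p ≠ ⊤ → 2 * ν + 2 < D * p.toReal) {h : ℂ → ℂ} (hd : Differentiable ℂ h)
    (he : ∀ z, h (-z) = h z) {M σ A : ℝ} (hσ : 0 < σ) (hσ1 : σ < 1) (hM : 0 ≤ M)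
    (hb : ∀ z, ‖h z‖ ≤ M * Real.exp (σ * |z.im|)) (hA : 0 ≤ A)
    (hdec : ∀ x : ℝ, ‖h x‖ ≤ A * (1 + |x|)⁻¹ ^ D) :
    ‖(besselOp ν)^[N] h 0‖ₑ / eLpNorm (fun t : ℝ => h t) p (muI ν) ≤
      liminf (aseq ν N p) atTop := by
  have hc := hd.continuous
  obtain ⟨A₁, q, hA₁, hq0, hq1, hR⟩ := cheb_trunc hd he hσ hσ1 hM hb
  choose R hdeg hRb using hR
  have hbR : ∀ x : ℝ, ‖h x‖ ≤ M := by
    intro x; simpa using hb x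
  have hq1n : ∀ n : ℕ, q ^ n ≤ 1 := fun n => pow_le_one₀ hq0.le hq1.le
  have hbd : ∀ n, ∀ t ∈ Set.Icc (-1:ℝ) 1, ‖(R n).eval (t:ℂ)‖ ≤ M + A₁ := by
    intro n t ht
    have h1 := hRb n (Real.arccos t)
    rw [Real.cos_arccos ht.1 ht.2] at h1
    have h2 := norm_le_norm_add_norm_sub' ((R n).eval (t:ℂ))
      (h ((2 * n * Real.sin (Real.arccos t / 2) : ℝ) : ℂ))
    have h3 := hbR (2 * n * Real.sin (Real.arccos t / 2))
    have h4 : A₁ * q ^ n ≤ A₁ := mul_le_of_le_one_right hA₁ (hq1n n)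
    linarith
  have hqt : Tendsto (fun n : ℕ => A₁ * q ^ n) atTop (𝓝 0) := by
    simpa using (tendsto_pow_atTop_nhds_zero_of_lt_one hq0.le hq1).const_mul A₁
  have hpt : ∀ x : ℝ, Tendsto (fun n : ℕ => (R n).eval ((Real.cos (x / n) : ℝ) : ℂ)) atTop
      (𝓝 (h x)) := by
    intro x
    have h1 : Tendsto (fun n : ℕ => (R n).eval ((Real.cos (x / n) : ℝ) : ℂ)
        - h ((2 * n * Real.sin (x / n / 2) : ℝ) : ℂ)) atTop (𝓝 0) :=
      squeeze_zero_norm (fun n => hRb n (x / n)) hqt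
    have h2 : Tendsto (fun n : ℕ => (2 * n * Real.sin (x / n / 2) : ℝ)) atTop (𝓝 x) := by
      have := sin_scale (a := fun n : ℕ => 2 * (n:ℝ))
        (tendsto_natCast_atTop_atTop.const_mul_atTop (by norm_num)) x
      refine this.congr fun n => ?_
      rw [div_div, mul_comm (n:ℝ) 2]
    have h3 : Tendsto (fun n : ℕ => h ((2 * n * Real.sin (x / n / 2) : ℝ) : ℂ)) atTop (𝓝 (h x)) :=
      ((hc.comp Complex.continuous_ofReal).tendsto x).comp h2
    simpa using h1.add h3
  have hxv : Tendsto (fun n : ℕ => xval ν N n (R n)) atTop (𝓝 ((besselOp ν)^[N] h 0)) := by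
    rw [← tendsto_add_atTop_iff_nat 1]
    apply tendsto_of_subseq_tendsto
    intro ns hns
    have hns1 : Tendsto (fun k => ns k + 1) atTop atTop := (tendsto_add_atTop_nat 1).comp hns
    obtain ⟨φ, F, hφ, hF, -, hFx, hFv⟩ := compactness (n := fun k => ns k + 1)
      (R := fun k => R (ns k + 1)) (M := M + A₁) hns1
      (fun k => Nat.succ_pos _) (fun k => hdeg _) (fun k => hbd _)
    refine ⟨φ, ?_⟩
    have hFh : (fun z => F (z^2/2)) = h := by
      apply eq_of_real _ hd
      · intro x
        exact tendsto_nhds_unique (hFx x) ((hpt x).comp (hns1.comp hφ.tendsto_atTop))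
      · intro z; exact (hF _).comp z (by fun_prop)
    have := hFv ν N
    rw [hFh] at this
    exact this
  have hY : ∃ Y : ℕ → ℝ≥0∞, Tendsto Y atTop (𝓝 (eLpNorm (fun t : ℝ => h t) p (muI ν))) ∧
      ∀ n, 0 < n → ynorm ν p n (R n) ≤ Y n := by
    by_cases hpt' : p = ⊤
    · subst hpt'
      refine ⟨fun n => eLpNorm (fun t : ℝ => h t) ⊤ (muI ν) + ENNReal.ofReal (A₁ * q ^ n), ?_, ?_⟩
      · have h1 := (ENNReal.continuous_ofReal.tendsto _).comp hqt
        have h2 := (tendsto_const_nhds (x := eLpNorm (fun t : ℝ => h t) ⊤ (muI ν))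
          (f := atTop (α := ℕ))).add h1
        simpa using h2
      · intro n _
        rw [ynorm, eLpNorm_exponent_top]
        refine eLpNormEssSup_le_of_ae_enorm_bound (Eventually.of_forall fun x => ?_)
        have h1 := sup_le_eLpNorm_top ν (h := fun t : ℝ => h t) (by fun_prop)
          (2 * n * Real.sin (x / n / 2))
        rw [eLpNorm_wMeasR ν ⊤ (by fun_prop) (by intro x; push_cast; exact he x)] at h1
        simp only [ENNReal.toReal_top, _root_.div_zero, Real.rpow_zero, ENNReal.ofReal_one, one_mul] at h1
        have h2 : ‖(R n).eval ((Real.cos (x / n) : ℝ) : ℂ)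
            - h ((2 * n * Real.sin (x / n / 2) : ℝ) : ℂ)‖ₑ ≤ ENNReal.ofReal (A₁ * q ^ n) := by
          rw [← ofReal_norm]; exact ENNReal.ofReal_le_ofReal (hRb n (x / n))
        calc ‖(R n).eval ((Real.cos (x / n) : ℝ) : ℂ)‖ₑ
            = ‖h ((2 * n * Real.sin (x / n / 2) : ℝ) : ℂ) + ((R n).eval ((Real.cos (x / n) : ℝ) : ℂ)
            - h ((2 * n * Real.sin (x / n / 2) : ℝ) : ℂ))‖ₑ := by congr 1; ring
          _ ≤ _ := enorm_add_le _ _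
          _ ≤ _ := add_le_add h1 h2
    · refine ⟨fun n => ynorm ν p n (R n), ?_, fun n _ => le_rfl⟩
      have hp0 : p ≠ 0 := hp.ne'
      have hq : 0 < p.toReal := ENNReal.toReal_pos hp0 hpt'
      obtain ⟨C₂, hC₂, hgeo⟩ := geo_decay hq0 hq1 D
      set B := A * 2 ^ D + A₁ * C₂ with hB
      have hB0 : 0 ≤ B := by positivity
      have hdom : ∀ n : ℕ, 0 < n → ∀ x ∈ Set.Ioo (0:ℝ) (n * Real.pi),
          ‖(R n).eval ((Real.cos (x / n) : ℝ) : ℂ)‖ ≤ B * (1 + |x|)⁻¹ ^ D := by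
        intro n hn x hx
        have hn' : (0:ℝ) < n := by exact_mod_cast hn
        have h1 := hRb n (x / n)
        have h2 := norm_le_norm_add_norm_sub' ((R n).eval ((Real.cos (x / n) : ℝ) : ℂ))
          (h ((2 * n * Real.sin (x / n / 2) : ℝ) : ℂ))
        have h3 := hdec (2 * n * Real.sin (x / n / 2))
        have h4 := hgeo n hn x hx.1.le hx.2.le
        have h5 : (1 + x) / 2 ≤ 1 + |2 * n * Real.sin (x / n / 2)| := by
          have h6 := Real.mul_le_sin (x := x / n / 2) (by have := hx.1; positivity) (by
            have : x / n ≤ Real.pi := by rw [div_le_iff₀ hn', mul_comm]; exact hx.2.le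
            linarith)
          have h7 : x / 2 ≤ 2 * n * Real.sin (x / n / 2) := by
            have e : 2 * n * (2 / Real.pi * (x / n / 2)) = 2 * x / Real.pi := by field_simp
            calc x / 2 ≤ 2 * x / Real.pi := by
                  rw [div_le_div_iff₀ (by norm_num) Real.pi_pos]
                  nlinarith [Real.pi_le_four, hx.1]
              _ = 2 * n * (2 / Real.pi * (x / n / 2)) := e.symm
              _ ≤ _ := by gcongr
          have := le_abs_self (2 * n * Real.sin (x / n / 2))
          linarith
        have hx0 := hx.1
        have h8 : (1 + |2 * n * Real.sin (x / n / 2)|)⁻¹ ^ D ≤ 2 ^ D * (1 + x)⁻¹ ^ D := by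
          rw [← mul_pow]
          gcongr
          calc _ ≤ ((1 + x) / 2)⁻¹ := by gcongr
            _ = _ := by rw [inv_div]; rfl
        rw [abs_of_pos hx.1]
        calc _ ≤ A * (1 + |2 * n * Real.sin (x / n / 2)|)⁻¹ ^ D + A₁ * q ^ n := by linarith
          _ ≤ A * (2 ^ D * (1 + x)⁻¹ ^ D) + A₁ * (C₂ * (1 + x)⁻¹ ^ D) := by gcongr
          _ = _ := by rw [hB]; ring
      have key : Tendsto (fun n : ℕ => ∫⁻ x, ‖(R n).eval ((Real.cos (x / n) : ℝ) : ℂ)‖ₑ ^ p.toReal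
          ∂(muN ν n)) atTop (𝓝 (∫⁻ x : ℝ, ‖h x‖ₑ ^ p.toReal ∂(muI ν))) := by
        have hm : ∀ f : ℂ → ℂ, Continuous f → Measurable (fun x : ℝ => ‖f x‖ₑ ^ p.toReal) := by
          intro f hf
          exact (show Continuous (fun x : ℝ => ‖f x‖ₑ) by fun_prop).measurable.pow_const _
        have hmR : ∀ n : ℕ, Measurable
            (fun x : ℝ => ‖(R n).eval ((Real.cos (x / n) : ℝ) : ℂ)‖ₑ ^ p.toReal) := by
          intro n
          exact (show Continuous (fun x : ℝ => ‖(R n).eval ((Real.cos (x / n) : ℝ) : ℂ)‖ₑ) by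
            fun_prop).measurable.pow_const _
        rw [← tendsto_add_atTop_iff_nat 1]
        rw [lintegral_muI ν (hm h hc)]
        have e : ∀ n : ℕ, ∫⁻ x, ‖(R n).eval ((Real.cos (x / n) : ℝ) : ℂ)‖ₑ ^ p.toReal
          ∂(muN ν n) = _ := fun n => lintegral_muN ν n (hmR n)
        simp only [e]
        refine tendsto_lintegral_of_dominated_convergence
          (fun x : ℝ => ENNReal.ofReal (|x| ^ (2 * ν + 1)) *
            ENNReal.ofReal (B * (1 + |x|)⁻¹ ^ D) ^ p.toReal) ?_ ?_
          (dom_int hν hq (hD hpt') hB0) ?_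
        · intro n
          exact Measurable.indicator (Measurable.mul (by fun_prop) (hmR (n+1))) measurableSet_Ioo
        · intro n
          refine Eventually.of_forall fun x => ?_
          by_cases hx : x ∈ Set.Ioo (0:ℝ) ((n + 1 : ℕ) * Real.pi)
          · rw [Set.indicator_of_mem hx]
            have hs := sin_div_pos (Nat.succ_pos n) hx
            have hx0 := hx.1
            have hn' : (0:ℝ) < ((n + 1 : ℕ) : ℝ) := by positivity
            beta_reduce
            gcongr ENNReal.ofReal ?_ * ?_ ^ p.toReal
            · refine Real.rpow_le_rpow (by positivity) ?_ (by linarith)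
              rw [abs_of_pos hx0]
              have := Real.sin_le (x := x / ((n + 1 : ℕ) : ℝ)) (by positivity)
              calc _ ≤ ((n + 1 : ℕ) : ℝ) * (x / ((n + 1 : ℕ) : ℝ)) := by gcongr
                _ = x := by field_simp
            · rw [← ofReal_norm]
              exact ENNReal.ofReal_le_ofReal (hdom _ (Nat.succ_pos n) x hx)
          · rw [Set.indicator_of_notMem hx]; exact bot_le
        · refine Eventually.of_forall fun x => ?_
          refine indicator_tendsto hν (n := fun k => k + 1) (tendsto_add_atTop_nat 1)
            (g := fun k x => ‖(R (k+1)).eval ((Real.cos (x / (k+1:ℕ)) : ℝ) : ℂ)‖ₑ ^ p.toReal)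
            (G := fun x : ℝ => ‖h x‖ₑ ^ p.toReal) (fun x _ => ?_) (fun x _ => ?_) x
          · exact ENNReal.rpow_ne_top_of_nonneg hq.le enorm_ne_top
          · refine (ENNReal.continuous_rpow_const.tendsto _).comp ?_
            refine (continuous_enorm.tendsto _).comp ?_
            exact (hpt x).comp (tendsto_add_atTop_nat 1)
      simp only [ynorm, eLpNorm_eq_lintegral_rpow_enorm_toReal hp0 hpt']
      exact (ENNReal.continuous_rpow_const.tendsto _).comp key
  obtain ⟨Y, hYt, hYle⟩ := hY
  set x := ‖(besselOp ν)^[N] h 0‖ₑ with hxdef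
  by_cases hx0 : x = 0
  · rw [hx0]; simp
  have hxt : Tendsto (fun n : ℕ => ‖xval ν N n (R n)‖ₑ) atTop (𝓝 x) :=
    (continuous_enorm.tendsto _).comp hxv
  have hlim := ENNReal.Tendsto.div hxt (Or.inl hx0) hYt (Or.inr enorm_ne_top)
  rw [← hlim.liminf_eq]
  apply liminf_le_liminf _ (by isBoundedDefault) (by isBoundedDefault)
  filter_upwards [eventually_gt_atTop 0] with n hn
  refine le_trans ?_ (aseq_ge ν N p hn (hdeg n))
  exact ENNReal.div_le_div_left (hYle n hn) _

lemma bessel_prod_tendsto (ν : ℝ) (N : ℕ) {f g : ℂ → ℂ} (hf : Differentiable ℂ f)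
    (hfe : ∀ z, f (-z) = f z) (hg : Differentiable ℂ g) (hge : ∀ z, g (-z) = g z) (hg0 : g 0 = 1)
    {τ δ : ℕ → ℝ} (hτ : Tendsto τ atTop (𝓝 1)) (hδ : Tendsto δ atTop (𝓝 0)) :
    Tendsto (fun k => (besselOp ν)^[N] (fun z => f (τ k * z) * g (δ k * z)) 0) atTop
      (𝓝 ((besselOp ν)^[N] f 0)) := by
  obtain ⟨F, hF, hFe⟩ := even_rep hf hfe
  obtain ⟨G, hG, hGe⟩ := even_rep hg hge
  obtain ⟨c, hc⟩ := seqOp_iter_zero ν N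
  have hG0 : G 0 = 1 := by rw [← hg0, hGe 0]; simp
  have key : ∀ a b : ℂ, (besselOp ν)^[N] (fun z => f (a * z) * g (b * z)) 0 =
      c 0 * ((∑ i ∈ Finset.range (N + 1), (N.choose i : ℂ) * ((a^2) ^ i * iteratedDeriv i F 0) *
        ((b^2) ^ (N - i) * iteratedDeriv (N - i) G 0)) / (N.factorial : ℂ)) := by
    intro a b
    have e : (fun z => f (a * z) * g (b * z)) =
        fun z => (fun s => F (a^2 * s) * G (b^2 * s)) (z^2/2) := by
      funext z
      rw [hFe, hGe]
      congr 2 <;> ring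
    have hFa : Differentiable ℂ (fun s => F (a^2 * s)) := by
      intro z; exact (hF _).comp z (by fun_prop)
    have hGb : Differentiable ℂ (fun s => G (b^2 * s)) := by
      intro z; exact (hG _).comp z (by fun_prop)
    rw [e, besselOp_iter ν N (hFa.fun_mul hGb), hc, zero_add, tay]
    congr 2
    rw [iteratedDeriv_fun_mul hFa.contDiff.contDiffAt hGb.contDiff.contDiffAt]
    apply Finset.sum_congr rfl
    intro i _
    rw [iteratedDeriv_comp_const_mul hF.contDiff, iteratedDeriv_comp_const_mul hG.contDiff]
    simp
  have hlim : (besselOp ν)^[N] f 0 = (besselOp ν)^[N] (fun z => f (1 * z) * g (0 * z)) 0 := by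
    simp [hg0]
  rw [hlim]
  simp only [key]
  have hτ' : Tendsto (fun k => (τ k : ℂ)) atTop (𝓝 1) := by
    have := (Complex.continuous_ofReal.tendsto _).comp hτ
    rwa [Complex.ofReal_one] at this
  have hδ' : Tendsto (fun k => (δ k : ℂ)) atTop (𝓝 0) := by
    have := (Complex.continuous_ofReal.tendsto _).comp hδ
    rwa [Complex.ofReal_zero] at this
  refine Tendsto.const_mul _ (Tendsto.div_const ?_ _)
  refine tendsto_finsetSum _ fun i _ => ?_
  exact (((hτ'.pow 2).pow i |>.mul_const _).const_mul _).mul (((hδ'.pow 2).pow _).mul_const _)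

lemma lemma_L {ν : ℝ} (hν : -(1/2 : ℝ) ≤ ν) (N : ℕ) {p : ℝ≥0∞} (hp : 0 < p) {f : ℂ → ℂ}
    (hf : Adm ν p f) :
    ‖(besselOp ν)^[N] f 0‖ₑ / eLpNorm (fun t : ℝ => f t) p (muI ν) ≤
      liminf (aseq ν N p) atTop := by
  obtain ⟨hft, hfe, -, hfin⟩ := hf
  have hfd := hft.1
  have hfc := hfd.continuous
  have hcd := csinc_diff
  obtain ⟨B, K, hB, hgrow⟩ := poly_growth hν hp hft hfin
  obtain ⟨D, hD⟩ := exists_D ν hp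
  set m := K + D + 1 with hm
  have hm0 : (0:ℝ) < m := by positivity
  set g : ℂ → ℂ := fun z => csinc z ^ m with hg
  have hgd : Differentiable ℂ g := hcd.fun_pow m
  have hgc := hgd.continuous
  have hge : ∀ z, g (-z) = g z := by intro z; simp [hg, csinc_neg]
  set E := eLpNorm (fun t : ℝ => f t) p (wMeasR ν) with hE
  have main : ∀ τ : ℝ, 0 < τ → τ < 1 → ENNReal.ofReal ((2 : ℝ) ^ (1 / p.toReal)) *
      (‖(besselOp ν)^[N] (fun z => f (τ * z) * g (((1 - τ) / (2 * m) : ℝ) * z)) 0‖ₑ /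
        (ENNReal.ofReal (τ ^ (-(2 * ν + 2) / p.toReal)) * E)) ≤ liminf (aseq ν N p) atTop := by
    intro τ hτ0 hτ1
    set δ := (1 - τ) / (2 * m) with hδ
    have hδ0 : 0 < δ := div_pos (by linarith) (by positivity)
    have hmδ : m * δ = (1 - τ) / 2 := by rw [hδ]; field_simp
    set h : ℂ → ℂ := fun z => f (τ * z) * g (δ * z) with hh
    have hfτ : Differentiable ℂ (fun z => f (τ * z)) := by
      intro z; exact (hfd _).comp z (by fun_prop)
    have hgδ : Differentiable ℂ (fun z => g (δ * z)) := by
      intro z; exact (hgd _).comp z (by fun_prop)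
    have hhd : Differentiable ℂ h := hfτ.mul hgδ
    have hhe : ∀ z, h (-z) = h z := by
      intro z; simp only [hh, mul_neg, hfe, hge]
    obtain ⟨A, hA, hdec⟩ := csinc_decay hδ0 m
    obtain ⟨A', hA', hbd⟩ := csinc_pow_bound hδ0 m
    have hdecay : ∀ x : ℝ, ‖h x‖ ≤ (B * A) * (1 + |x|)⁻¹ ^ D := by
      intro x
      have h1 := hgrow (τ * x)
      have h2 := hdec x
      have h3 : |τ * x| ≤ |x| := by
        rw [abs_mul, abs_of_pos hτ0]
        exact mul_le_of_le_one_left (abs_nonneg _) hτ1.le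
      have h0 : 0 < 1 + |x| := by positivity
      have h5 : (1 + |x|)⁻¹ ≤ 1 := inv_le_one_of_one_le₀ (by linarith [abs_nonneg x])
      have h4 : (1 + |x|) ^ K * (1 + |x|)⁻¹ ^ m = (1 + |x|)⁻¹ ^ D * (1 + |x|)⁻¹ := by
        rw [hm, pow_succ, pow_add, ← mul_assoc, ← mul_assoc, ← mul_pow,
          mul_inv_cancel₀ h0.ne', one_pow, one_mul]
      simp only [hh, hg, norm_mul]
      push_cast at h1
      calc ‖f (τ * x)‖ * ‖csinc (δ * x) ^ m‖
          ≤ (B * (1 + |τ * x|) ^ K) * (A * (1 + |x|)⁻¹ ^ m) := by gcongr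
        _ ≤ (B * (1 + |x|) ^ K) * (A * (1 + |x|)⁻¹ ^ m) := by gcongr
        _ = (B * A) * ((1 + |x|) ^ K * (1 + |x|)⁻¹ ^ m) := by ring
        _ = (B * A) * ((1 + |x|)⁻¹ ^ D * (1 + |x|)⁻¹) := by rw [h4]
        _ ≤ (B * A) * ((1 + |x|)⁻¹ ^ D * 1) := by gcongr
        _ = _ := by ring
    have hbR : ∀ x : ℝ, ‖h x‖ ≤ B * A := by
      intro x
      refine (hdecay x).trans (mul_le_of_le_one_right (by positivity) (pow_le_one₀ (by positivity) ?_))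
      exact inv_le_one_of_one_le₀ (by linarith [abs_nonneg x])
    have htype : SphericalType1 ((1 + τ) / 2) h := by
      refine ⟨hhd, fun ε hε => ?_⟩
      obtain ⟨C, hC⟩ := hft.2 ε hε
      refine ⟨C * A', fun z => ?_⟩
      have h1 := hC (τ * z)
      have h2 := hbd z
      rw [norm_mul, Complex.norm_real, Real.norm_of_nonneg hτ0.le, one_mul] at h1
      rw [hmδ] at h2
      have hC0 : 0 ≤ C := by
        have := (norm_nonneg _).trans h1
        exact nonneg_of_mul_nonneg_left this (Real.exp_pos _)
      simp only [hh, hg, norm_mul]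
      calc ‖f (τ * z)‖ * ‖csinc (δ * z) ^ m‖
          ≤ (C * Real.exp ((1 + ε) * (τ * ‖z‖))) * (A' * Real.exp ((1 - τ) / 2 * ‖z‖)) := by gcongr
        _ = C * A' * Real.exp ((1 + ε) * (τ * ‖z‖) + (1 - τ) / 2 * ‖z‖) := by
          rw [Real.exp_add]; ring
        _ ≤ _ := by
          gcongr
          have : 0 ≤ ε * ((1 - τ) / 2) * ‖z‖ := by
            have : 0 < 1 - τ := by linarith
            positivity
          nlinarith
    have hcore := core_L hν N hp hD hhd hhe (σ := (1 + τ) / 2) (M := B * A) (A := B * A)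
      (by positivity) (by linarith) (by positivity)
      (pl_bound (by positivity) htype hbR) (by positivity) hdecay
    rw [← ratio_eq ν p hhd hhe] at hcore
    refine le_trans ?_ hcore
    gcongr
    rw [hE, ← eLpNorm_dilate ν p (f := fun t : ℝ => f t) (by fun_prop) hτ0]
    apply eLpNorm_mono
    intro x
    simp only [hh, hg, norm_mul, norm_pow]
    push_cast
    refine mul_le_of_le_one_right (norm_nonneg _) (pow_le_one₀ (norm_nonneg _) ?_)
    have := csinc_real_le_one (δ * x)
    push_cast at this
    exact this
  rw [← ratio_eq ν p hfd hfe, ← hE]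
  set X := ‖(besselOp ν)^[N] f 0‖ₑ with hX
  by_cases hX0 : X = 0
  · rw [hX0]; simp
  set τ : ℕ → ℝ := fun k => 1 - 1 / ((k:ℝ) + 2) with hτ
  have hτt : Tendsto τ atTop (𝓝 1) := by
    have h1 : Tendsto (fun k : ℕ => 1 / ((k:ℝ) + 2)) atTop (𝓝 0) := by
      have := (tendsto_one_div_add_atTop_nhds_zero_nat (𝕜 := ℝ)).comp (tendsto_add_atTop_nat 1)
      refine this.congr fun k => ?_
      simp only [Function.comp]
      push_cast
      congr 1; ring
    have h2 := h1.const_sub 1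
    rw [sub_zero] at h2
    exact h2
  have hτ0 : ∀ k, 0 < τ k := by
    intro k
    have : 1 / ((k:ℝ) + 2) < 1 := by
      rw [div_lt_one (by positivity)]
      have : (0:ℝ) ≤ k := by positivity
      linarith
    simp only [hτ]; linarith
  have hτ1 : ∀ k, τ k < 1 := by
    intro k
    have : 0 < 1 / ((k:ℝ) + 2) := by positivity
    simp only [hτ]; linarith
  have hδt : Tendsto (fun k => (1 - τ k) / (2 * m)) atTop (𝓝 0) := by
    have := (hτt.const_sub 1).div_const (2 * (m:ℝ))
    simpa using this
  have hXt := (continuous_enorm.tendsto _).comp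
    (bessel_prod_tendsto ν N hfd hfe hgd hge (by simp [hg, csinc_zero]) hτt hδt)
  have hEt : Tendsto (fun k => ENNReal.ofReal (τ k ^ (-(2 * ν + 2) / p.toReal)) * E) atTop (𝓝 E) := by
    have h1 := hτt.rpow_const (p := -(2 * ν + 2) / p.toReal) (Or.inl one_ne_zero)
    rw [Real.one_rpow] at h1
    have h2 := ENNReal.Tendsto.mul_const ((ENNReal.continuous_ofReal.tendsto _).comp h1)
      (Or.inr hfin)
    rw [ENNReal.ofReal_one, one_mul] at h2
    exact h2
  have hlim := ENNReal.Tendsto.const_mul (a := ENNReal.ofReal ((2 : ℝ) ^ (1 / p.toReal)))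
    (ENNReal.Tendsto.div hXt (Or.inl hX0) hEt (Or.inr enorm_ne_top)) (Or.inr ENNReal.ofReal_ne_top)
  exact le_of_tendsto hlim (Eventually.of_forall fun k => main (τ k) (hτ0 k) (hτ1 k))
/-- **Theorem 4.3.**  For `ν ≥ -1/2`, `N ≥ 0` and `p ∈ (0,∞]`,
`n^{-2N-(2ν+2)/p}` times the sharp Gegenbauer polynomial constant tends to `2^{1/p}`
times the sharp Bessel constant for even entire functions of exponential type `1`,
and the limit is attained by some nonzero `f₀ ∈ E_{1,1,e} ∩ L_{p,|t|^{2ν+1}}(ℝ)`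
(`1/∞ = 0`, `2^{1/∞} = 1`). -/
theorem limit_gegenbauer_sharp_constants
    {ν : ℝ} (hν : -(1/2 : ℝ) ≤ ν) (N : ℕ) (p : ℝ≥0∞) (hp : 0 < p) :
    Tendsto
      (fun n : ℕ =>
        ENNReal.ofReal ((n : ℝ) ^ (-(2 * (N : ℝ)) - (2 * ν + 2) / p.toReal)) *
          gegenPolyConst ν N p n)
      atTop (𝓝 (ENNReal.ofReal ((2 : ℝ) ^ (1 / p.toReal)) * entireConst ν N p)) ∧
    ∃ f₀ : ℂ → ℂ, SphericalType1 1 f₀ ∧ (∀ z : ℂ, f₀ (-z) = f₀ z) ∧ f₀ ≠ 0 ∧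
      eLpNorm (fun t : ℝ => f₀ t) p (wMeasR ν) ≠ ⊤ ∧
      Tendsto
        (fun n : ℕ =>
          ENNReal.ofReal ((n : ℝ) ^ (-(2 * (N : ℝ)) - (2 * ν + 2) / p.toReal)) *
            gegenPolyConst ν N p n)
        atTop
        (𝓝 (ENNReal.ofReal ((2 : ℝ) ^ (1 / p.toReal)) *
          ((‖(besselOp ν)^[N] f₀ 0‖₊ : ℝ≥0∞) /
            eLpNorm (fun t : ℝ => f₀ t) p (wMeasR ν)))) := by
  change Tendsto (aseq ν N p) atTop _ ∧ ∃ f₀ : ℂ → ℂ, _ ∧ _ ∧ _ ∧ _ ∧ Tendsto (aseq ν N p) atTop _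
  obtain ⟨f, hf, hle⟩ : ∃ f : ℂ → ℂ, Adm ν p f ∧ limsup (aseq ν N p) atTop ≤
      ‖(besselOp ν)^[N] f 0‖ₑ / eLpNorm (fun t : ℝ => f t) p (muI ν) := by
    by_cases hL : 0 < limsup (aseq ν N p) atTop
    · exact lemma_U hν N hp hL
    · obtain ⟨f, hf⟩ := exists_adm hν hp
      exact ⟨f, hf, (not_lt.1 hL).trans bot_le⟩
  have hT : Tendsto (aseq ν N p) atTop
      (𝓝 (‖(besselOp ν)^[N] f 0‖ₑ / eLpNorm (fun t : ℝ => f t) p (muI ν))) :=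
    tendsto_of_le_liminf_of_limsup_le (lemma_L hν N hp hf) hle
  have hT' := hT
  rw [← ratio_eq ν p hf.1.1 hf.2.1] at hT'
  refine ⟨?_, f, hf.1, hf.2.1, hf.2.2.1, hf.2.2.2, hT'⟩
  have hsup : entireConst ν N p = ‖(besselOp ν)^[N] f 0‖ₑ /
      eLpNorm (fun t : ℝ => f t) p (wMeasR ν) := by
    apply le_antisymm
    · refine iSup₂_le fun g hg => ?_
      have h1 : ‖(besselOp ν)^[N] g 0‖ₑ / eLpNorm (fun t : ℝ => g t) p (muI ν) ≤
          ‖(besselOp ν)^[N] f 0‖ₑ / eLpNorm (fun t : ℝ => f t) p (muI ν) := by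
        rw [← hT.liminf_eq]; exact lemma_L hν N hp hg
      rw [← ratio_eq ν p hf.1.1 hf.2.1, ← ratio_eq ν p hg.1.1 hg.2.1] at h1
      have h2 : ENNReal.ofReal ((2 : ℝ) ^ (1 / p.toReal)) ≠ 0 := by
        have : (0:ℝ) < 2 ^ (1 / p.toReal) := by positivity
        simpa using this
      exact (ENNReal.mul_le_mul_iff_right h2 ENNReal.ofReal_ne_top).1 h1
    · exact le_iSup₂_of_le (f := fun (g : ℂ → ℂ) (_ : SphericalType1 1 g ∧ (∀ z : ℂ, g (-z) = g z) ∧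
        g ≠ 0 ∧ eLpNorm (fun t : ℝ => g t) p (wMeasR ν) ≠ ⊤) =>
        (‖(besselOp ν)^[N] g 0‖₊ : ℝ≥0∞) / eLpNorm (fun t : ℝ => g t) p (wMeasR ν)) f hf le_rfl
  rw [hsup]
  exact hT'
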